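/- arXiv:2306.10842 — 2 statements merged into one kernel-verified Lean document; each statement's English description precedes it below -/
import Mathlib

section
/- Let K be a fractal square of order n with digit set D, and suppose K is a dendrite. Then for every point x ∈ K, the set K \ {x} has at most 4 connected components (equivalently, the Menger–Urysohn order of x in K is at most 4). -/
open Set Pointwise

noncomputable section

/-- The canonical embedding of `ℤ × ℤ` into `ℝ × ℝ`. -/
def coeZ2 (d : ℤ × ℤ) : ℝ × ℝ := ((d.1 : ℝ), (d.2 : ℝ))

/-- The contraction similarity `x ↦ (x + d) / n` of the plane. -/
def pieceMap (n : ℕ) (d : ℤ × ℤ) (x : ℝ × ℝ) : ℝ × ℝ := (n : ℝ)⁻¹ • (x + coeZ2 d)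

/-- `K` is a fractal square of order `n` with digit set `D ⊆ {0,…,n-1}²`,
`1 < |D| < n²`: a nonempty compact set with `K = (K + D)/n`. -/
def IsFractalSquare (n : ℕ) (D : Set (ℤ × ℤ)) (K : Set (ℝ × ℝ)) : Prop :=
  2 ≤ n ∧ D ⊆ Set.Icc (0, 0) ((n : ℤ) - 1, (n : ℤ) - 1) ∧
  1 < Nat.card D ∧ Nat.card D < n ^ 2 ∧
  K.Nonempty ∧ IsCompact K ∧
  K = ⋃ d ∈ D, pieceMap n d '' K

/-- A dendrite: a nonempty compact, connected, locally connected (planar) set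
containing no subset homeomorphic to the circle. -/
def IsDendrite (K : Set (ℝ × ℝ)) : Prop :=
  K.Nonempty ∧ IsCompact K ∧ IsConnected K ∧ LocallyConnectedSpace K ∧
  ¬ ∃ S : Set (ℝ × ℝ), S ⊆ K ∧ Nonempty (S ≃ₜ Circle)



theorem arc_exists_min {X : Type*} [MetricSpace X] (f : ℝ → X) (hf : Continuous f) :
    ∃ A : Set ℝ, IsClosed A ∧ A ⊆ Icc 0 1 ∧ (0:ℝ) ∈ A ∧ (1:ℝ) ∈ A ∧
      (∀ s ∈ A, ∀ t ∈ A, s < t → (∀ z ∈ A, z ∉ Ioo s t) → f s = f t) ∧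
      (∀ s ∈ A, ∀ t ∈ A, s < t → f s = f t → (∀ z ∈ A, z ∉ Ioo s t)) := by
  let S : Set (Set ℝ) := {A | IsClosed A ∧ A ⊆ Icc 0 1 ∧ (0:ℝ) ∈ A ∧ (1:ℝ) ∈ A ∧
      (∀ s ∈ A, ∀ t ∈ A, s < t → (∀ z ∈ A, z ∉ Ioo s t) → f s = f t)}
  have hI : Icc (0:ℝ) 1 ∈ S := by
    refine ⟨isClosed_Icc, subset_rfl, by simp, by simp, ?_⟩
    intro s hs t ht hst h
    exfalso
    refine h ((s+t)/2) ⟨?_, ?_⟩ ⟨?_, ?_⟩ <;> linarith [hs.1, hs.2, ht.1, ht.2]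
  obtain ⟨A, -, hA⟩ := zorn_superset_nonempty S (by
    intro c hcS hc hne
    refine ⟨⋂₀ c, ⟨?_, ?_, ?_, ?_, ?_⟩, fun s hs => sInter_subset_of_mem hs⟩
    · exact isClosed_sInter fun B hB => (hcS hB).1
    · obtain ⟨B, hB⟩ := hne
      exact (sInter_subset_of_mem hB).trans (hcS hB).2.1
    · exact fun B hB => (hcS hB).2.2.1
    · exact fun B hB => (hcS hB).2.2.2.1
    · intro s hs t ht hst hgap
      -- approximate
      have key : ∀ ε > 0, ε < (t - s)/2 → ∃ s' ∈ Icc s (s+ε), ∃ t' ∈ Icc (t-ε) t, f s' = f t' := by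
        intro ε hε hε2
        have hB : ∃ B ∈ c, ∀ z ∈ B, z ∉ Icc (s+ε) (t-ε) := by
          by_contra hcon
          push Not at hcon
          have : (⋂ B : c, (B.1 ∩ Icc (s+ε) (t-ε))).Nonempty := by
            have : Nonempty c := hne.to_subtype
            apply IsCompact.nonempty_iInter_of_directed_nonempty_isCompact_isClosed
            · intro B B'
              rcases hc.total B.2 B'.2 with h | h
              · exact ⟨B, subset_rfl, inter_subset_inter_left _ h⟩
              · exact ⟨B', inter_subset_inter_left _ h, subset_rfl⟩
            · intro B
              obtain ⟨z, hz, hz2⟩ := hcon B.1 B.2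
              exact ⟨z, hz, hz2⟩
            · intro B
              exact (isCompact_Icc.inter_left (hcS B.2).1)
            · intro B
              exact (hcS B.2).1.inter isClosed_Icc
          obtain ⟨z, hz⟩ := this
          simp only [mem_iInter] at hz
          have hz1 : z ∈ ⋂₀ c := fun B hB => (hz ⟨B, hB⟩).1
          obtain ⟨B0, hB0⟩ := hne
          have hz2 := (hz ⟨B0, hB0⟩).2
          exact hgap z hz1 ⟨by linarith [hz2.1], by linarith [hz2.2]⟩
        obtain ⟨B, hBc, hB⟩ := hB
        have hBS := hcS hBc
        have h1 : IsCompact (B ∩ Icc s (s+ε)) := isCompact_Icc.inter_left hBS.1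
        have h2 : IsCompact (B ∩ Icc (t-ε) t) := isCompact_Icc.inter_left hBS.1
        obtain ⟨s', hs', hs'm⟩ := h1.exists_isGreatest ⟨s, hs B hBc, by simp [hε.le]⟩
        obtain ⟨t', ht', ht'm⟩ := h2.exists_isLeast ⟨t, ht B hBc, by simp [hε.le]⟩
        refine ⟨s', hs'.2, t', ht'.2, ?_⟩
        apply hBS.2.2.2.2 s' hs'.1 t' ht'.1
        · linarith [hs'.2.2, ht'.2.1]
        · intro z hz hzz
          by_cases hz1 : z ≤ s + ε
          · have := hs'm ⟨hz, ⟨by linarith [hzz.1, hs'.2.1], hz1⟩⟩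
            linarith [hzz.1]
          · by_cases hz2 : t - ε ≤ z
            · have := ht'm ⟨hz, ⟨hz2, by linarith [hzz.2, ht'.2.2]⟩⟩
              linarith [hzz.2]
            · push Not at hz1 hz2
              exact hB z hz ⟨hz1.le, hz2.le⟩
      by_contra hne'
      have hd : 0 < dist (f s) (f t) := dist_pos.mpr hne'
      obtain ⟨δ1, hδ1, h1⟩ := Metric.continuous_iff.mp hf s (dist (f s) (f t)/2) (by positivity)
      obtain ⟨δ2, hδ2, h2⟩ := Metric.continuous_iff.mp hf t (dist (f s) (f t)/2) (by positivity)
      obtain ⟨ε, hε, hε2⟩ : ∃ ε > 0, ε < min (min δ1 δ2) ((t-s)/2) :=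
        exists_between (by simp only [lt_min_iff]; exact ⟨⟨hδ1, hδ2⟩, by linarith⟩)
      simp only [lt_min_iff] at hε2
      obtain ⟨s', hs', t', ht', he⟩ := key ε hε hε2.2
      have a1 := h1 s' (by rw [Real.dist_eq, abs_lt]; constructor <;> linarith [hs'.1, hs'.2])
      have a2 := h2 t' (by rw [Real.dist_eq, abs_lt]; constructor <;> linarith [ht'.1, ht'.2])
      rw [he] at a1
      have := dist_triangle_left (f s) (f t) (f t')
      linarith) _ hI
  have hAS : A ∈ S := hA.1
  refine ⟨A, hAS.1, hAS.2.1, hAS.2.2.1, hAS.2.2.2.1, hAS.2.2.2.2, ?_⟩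
  intro s hs t ht hst hfst z hz hzz
  have hmem : A \ Ioo s t ∈ S := by
    refine ⟨hAS.1.sdiff isOpen_Ioo, sdiff_subset.trans hAS.2.1, ⟨hAS.2.2.1, ?_⟩, ⟨hAS.2.2.2.1, ?_⟩, ?_⟩
    · intro h; linarith [h.1, (hAS.2.1 hs).1]
    · intro h; linarith [h.2, (hAS.2.1 ht).2]
    · intro u hu v hv huv hgap
      by_cases hg : ∀ z ∈ A, z ∉ Ioo u v
      · exact hAS.2.2.2.2 u hu.1 v hv.1 huv hg
      · push Not at hg
        obtain ⟨y, hyA, hy⟩ := hg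
        have hys : y ∈ Ioo s t := by
          by_contra hc
          exact hgap y ⟨hyA, hc⟩ hy
        have hus : u = s := by
          have h1 : u ≤ s := by
            by_contra hc
            push Not at hc
            exact hu.2 ⟨hc, by linarith [hy.1, hys.2]⟩
          by_contra hc
          have h2 : u < s := lt_of_le_of_ne h1 hc
          exact hgap s ⟨hs, by simp⟩ ⟨h2, by linarith [hys.1, hy.2]⟩
        have hvt : v = t := by
          have h1 : t ≤ v := by
            by_contra hc
            push Not at hc
            exact hv.2 ⟨by linarith [hy.2, hys.1], hc⟩
          by_contra hc
          have h2 : t < v := lt_of_le_of_ne h1 (Ne.symm hc)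
          exact hgap t ⟨ht, by simp⟩ ⟨by linarith [hys.2, hy.1], h2⟩
        rw [hus, hvt, hfst]
  have := hA.2 hmem sdiff_subset hz
  exact this.2 hzz

theorem arc_collapse {X : Type*} [MetricSpace X] (f : ℝ → X) (hf : Continuous f) :
    ∃ g : ℝ → X, ContinuousOn g (Icc 0 1) ∧ g 0 = f 0 ∧ g 1 = f 1 ∧
      (∀ t ∈ Icc (0:ℝ) 1, ∃ s ∈ Icc (0:ℝ) 1, g t = f s) ∧
      (∀ s ∈ Icc (0:ℝ) 1, ∀ t ∈ Icc (0:ℝ) 1, ∀ u, s ≤ u → u ≤ t → g s = g t → g u = g s) := by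
  obtain ⟨A, hAc, hAI, h0, h1, hgap, hmin⟩ := arc_exists_min f hf
  have hρ : ∀ t : ℝ, ∃ r, 0 ≤ t → (r ∈ A ∧ r ≤ t ∧ ∀ z ∈ A, z ≤ t → z ≤ r) := by
    intro t
    by_cases ht : 0 ≤ t
    · have hc : IsCompact (A ∩ Icc 0 t) := isCompact_Icc.inter_left hAc
      obtain ⟨r, hr, hrm⟩ := hc.exists_isGreatest ⟨0, h0, by simp [ht]⟩
      exact ⟨r, fun _ => ⟨hr.1, hr.2.2, fun z hz hzt => hrm ⟨hz, (hAI hz).1, hzt⟩⟩⟩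
    · exact ⟨0, fun h => absurd h ht⟩
  choose ρ hρ using hρ
  have hρA : ∀ t ∈ A, ρ t = t := fun t ht =>
    le_antisymm (hρ t (hAI ht).1).2.1 ((hρ t (hAI ht).1).2.2 t ht le_rfl)
  have hmono : ∀ s t, 0 ≤ s → s ≤ t → ρ s ≤ ρ t := fun s t hs hst =>
    (hρ t (hs.trans hst)).2.2 _ (hρ s hs).1 ((hρ s hs).2.1.trans hst)
  refine ⟨f ∘ ρ, ?_, by simp [hρA 0 h0], by simp [hρA 1 h1], ?_, ?_⟩
  · have huc : UniformContinuousOn f (Icc 0 1) :=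
      isCompact_Icc.uniformContinuousOn_of_continuous hf.continuousOn
    rw [Metric.uniformContinuousOn_iff] at huc
    have key : ∀ ε > 0, ∃ δ > 0, ∀ s ∈ Icc (0:ℝ) 1, ∀ t ∈ Icc (0:ℝ) 1, s ≤ t → t - s < δ →
        dist (f (ρ s)) (f (ρ t)) < ε := by
      intro ε hε
      obtain ⟨δ, hδ, h⟩ := huc ε hε
      refine ⟨δ, hδ, ?_⟩
      intro s hs t ht hst hlt
      by_cases hemp : ∃ z ∈ A, s ≤ z ∧ z ≤ t
      · obtain ⟨z, hz, hsz, hzt⟩ := hemp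
        have hc : IsCompact (A ∩ Icc s t) := isCompact_Icc.inter_left hAc
        obtain ⟨a, ha, ham⟩ := hc.exists_isLeast ⟨z, hz, hsz, hzt⟩
        have e1 : f (ρ s) = f a := by
          rcases eq_or_lt_of_le ((hρ s hs.1).2.1.trans ha.2.1) with h' | h'
          · rw [h']
          · apply hgap _ (hρ s hs.1).1 _ ha.1 h'
            intro y hy hyy
            by_cases hys : y ≤ s
            · have := (hρ s hs.1).2.2 y hy hys
              linarith [hyy.1]
            · have := ham ⟨hy, by linarith, by linarith [hyy.2, ha.2.2]⟩
              linarith [hyy.2]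
        rw [e1]
        have h3 := (hρ t ht.1).2.2 a ha.1 ha.2.2
        apply h a (hAI ha.1) _ (hAI (hρ t ht.1).1)
        rw [Real.dist_eq, abs_lt]
        constructor <;> linarith [(hρ t ht.1).2.1, ha.2.1]
      · have : ρ s = ρ t := by
          apply le_antisymm (hmono s t hs.1 hst)
          apply (hρ s hs.1).2.2 _ (hρ t ht.1).1
          by_contra hc
          push Not at hc
          exact hemp ⟨ρ t, (hρ t ht.1).1, hc.le, (hρ t ht.1).2.1⟩
        rw [this, dist_self]; exact hε
    rw [Metric.continuousOn_iff]
    intro b hb ε hε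
    obtain ⟨δ, hδ, h⟩ := key ε hε
    refine ⟨δ, hδ, fun a ha hab => ?_⟩
    rw [Real.dist_eq, abs_lt] at hab
    rcases le_total a b with h' | h'
    · exact h a ha b hb h' (by linarith)
    · rw [dist_comm]; exact h b hb a ha h' (by linarith)
  · intro t ht
    exact ⟨ρ t, hAI (hρ t ht.1).1, rfl⟩
  · intro s hs t ht u hsu hut he
    have hu0 : 0 ≤ u := hs.1.trans hsu
    simp only [Function.comp] at *
    have h1 := hmono s u hs.1 hsu
    have h2 := hmono u t hu0 hut
    by_contra hne
    have h1' : ρ s < ρ u := lt_of_le_of_ne h1 (fun h => hne (by rw [h]))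
    have h2' : ρ u < ρ t := lt_of_le_of_ne h2 (fun h => hne (by rw [h, he]))
    exact hmin _ (hρ s hs.1).1 _ (hρ t ht.1).1 (h1'.trans h2') he _ (hρ u hu0).1 ⟨h1', h2'⟩



theorem arc_param {X : Type*} [MetricSpace X] (g : ℝ → X) (hg : ContinuousOn g (Icc 0 1))
    (hne : g 0 ≠ g 1)
    (hfib : ∀ s ∈ Icc (0:ℝ) 1, ∀ t ∈ Icc (0:ℝ) 1, ∀ u, s ≤ u → u ≤ t → g s = g t → g u = g s) :
    ∃ h : unitInterval → X, Continuous h ∧ Function.Injective h ∧ h 0 = g 0 ∧ h 1 = g 1 ∧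
      range h ⊆ g '' Icc 0 1 := by
  let r : ℕ → ℝ := fun k => max 0 (TopologicalSpace.denseSeq ℝ k)
  have hr0 : ∀ k, 0 ≤ r k := fun k => le_max_left _ _
  have hrd : ∀ s t : ℝ, 0 ≤ s → s < t → ∃ k, s < r k ∧ r k < t := by
    intro s t hs hst
    obtain ⟨k, hk⟩ := (TopologicalSpace.denseRange_denseSeq ℝ).exists_mem_open isOpen_Ioo
      (nonempty_Ioo.mpr hst)
    refine ⟨k, ?_, ?_⟩
    · exact lt_max_of_lt_right hk.1
    · exact max_lt (by linarith) hk.2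
  have hbd : Bornology.IsBounded (g '' Icc 0 1) := (isCompact_Icc.image_of_continuousOn hg).isBounded
  have hsub : ∀ k t, t ≤ 1 → g '' Icc (r k) t ⊆ g '' Icc 0 1 := fun k t ht =>
    image_mono (Icc_subset_Icc (hr0 k) ht)
  let φ : ℕ → ℝ → ℝ := fun k t => Metric.diam (g '' Icc (r k) t)
  let M := Metric.diam (g '' Icc 0 1)
  have hφ0 : ∀ k t, 0 ≤ φ k t := fun k t => Metric.diam_nonneg
  have hφM : ∀ k t, t ≤ 1 → φ k t ≤ M := fun k t ht => Metric.diam_mono (hsub k t ht) hbd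
  have hmono : ∀ k s t, s ≤ t → t ≤ 1 → φ k s ≤ φ k t := fun k s t hst ht =>
    Metric.diam_mono (image_mono (Icc_subset_Icc le_rfl hst)) (hbd.subset (hsub k t ht))
  have hstep : ∀ k, ∀ s ∈ Icc (0:ℝ) 1, ∀ t ∈ Icc (0:ℝ) 1, s ≤ t → ∀ ε ≥ 0,
      (∀ u, s ≤ u → u ≤ t → dist (g u) (g s) ≤ ε) → φ k t ≤ φ k s + 2 * ε := by
    intro k s hs t ht hst ε hε h
    apply Metric.diam_le_of_forall_dist_le (by have := hφ0 k s; positivity)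
    have main : ∀ u ∈ Icc (r k) t, ∀ v ∈ Icc (r k) t, u ≤ v → dist (g u) (g v) ≤ φ k s + 2 * ε := by
      intro u hu v hv huv
      by_cases hus : u ≤ s
      · by_cases hvs : v ≤ s
        · have : dist (g u) (g v) ≤ φ k s := Metric.dist_le_diam_of_mem (hbd.subset (hsub k s hs.2))
            ⟨u, ⟨hu.1, hus⟩, rfl⟩ ⟨v, ⟨hv.1, hvs⟩, rfl⟩
          linarith
        · have h1 : dist (g u) (g s) ≤ φ k s := Metric.dist_le_diam_of_mem (hbd.subset (hsub k s hs.2))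
            ⟨u, ⟨hu.1, hus⟩, rfl⟩ ⟨s, ⟨hu.1.trans hus, le_rfl⟩, rfl⟩
          have h2 := h v (by linarith) hv.2
          have := dist_triangle_right (g u) (g v) (g s)
          linarith
      · have h1 := h u (by linarith) hu.2
        have h2 := h v (by linarith) hv.2
        have := dist_triangle_right (g u) (g v) (g s)
        linarith [hφ0 k s]
    rintro _ ⟨u, hu, rfl⟩ _ ⟨v, hv, rfl⟩
    rcases le_total u v with h' | h'
    · exact main u hu v hv h'
    · rw [dist_comm]; exact main v hv u hu h'
  have hcont : ∀ k, ContinuousOn (φ k) (Icc 0 1) := by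
    intro k
    have huc := isCompact_Icc.uniformContinuousOn_of_continuous hg
    rw [Metric.uniformContinuousOn_iff] at huc
    rw [Metric.continuousOn_iff]
    intro b hb ε hε
    obtain ⟨δ, hδ, h⟩ := huc (ε/4) (by positivity)
    have key : ∀ s ∈ Icc (0:ℝ) 1, ∀ t ∈ Icc (0:ℝ) 1, s ≤ t → t - s < δ →
        |φ k t - φ k s| < ε := by
      intro s hs t ht hst hlt
      have h1 := hstep k s hs t ht hst (ε/4) (by positivity) (fun u hsu hut =>
        (h u ⟨hs.1.trans hsu, hut.trans ht.2⟩ s hs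
          (by rw [Real.dist_eq, abs_lt]; constructor <;> linarith)).le)
      have h2 := hmono k s t hst ht.2
      rw [abs_lt]; constructor <;> linarith
    refine ⟨δ, hδ, fun a ha hab => ?_⟩
    rw [Real.dist_eq, abs_lt] at hab
    rcases le_total a b with h' | h'
    · rw [dist_comm, Real.dist_eq]; exact key a ha b hb h' (by linarith)
    · rw [Real.dist_eq]; exact key b hb a ha h' (by linarith)
  let Φ : ℝ → ℝ := fun t => ∑' k, (1/2 : ℝ)^k * φ k t
  have hsumM : Summable (fun k : ℕ => (1/2 : ℝ)^k * M) := summable_geometric_two.mul_right M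
  have hsum : ∀ t, t ≤ 1 → Summable (fun k => (1/2 : ℝ)^k * φ k t) := fun t ht =>
    Summable.of_nonneg_of_le (fun k => mul_nonneg (by positivity) (hφ0 k t))
      (fun k => mul_le_mul_of_nonneg_left (hφM k t ht) (by positivity)) hsumM
  have hΦc : ContinuousOn Φ (Icc 0 1) := by
    apply continuousOn_tsum (fun k => (hcont k).const_mul _) hsumM
    intro k t ht
    rw [Real.norm_of_nonneg (mul_nonneg (by positivity) (hφ0 k t))]
    exact mul_le_mul_of_nonneg_left (hφM k t ht.2) (by positivity)
  have hΦ0 : Φ 0 = 0 := by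
    have : ∀ k, φ k 0 = 0 := by
      intro k
      apply Metric.diam_subsingleton
      apply Set.Subsingleton.image
      intro a ha b hb
      have := hr0 k
      linarith [ha.1, ha.2, hb.1, hb.2]
    simp [Φ, this]
  have hΦm : ∀ s t, s ≤ t → t ≤ 1 → Φ s ≤ Φ t := fun s t hst ht =>
    (hsum s (hst.trans ht)).tsum_le_tsum
      (fun k => mul_le_mul_of_nonneg_left (hmono k s t hst ht) (by positivity)) (hsum t ht)
  have hΦs : ∀ s ∈ Icc (0:ℝ) 1, ∀ t ∈ Icc (0:ℝ) 1, s ≤ t → (Φ s = Φ t ↔ g s = g t) := by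
    intro s hs t ht hst
    constructor
    · intro he
      by_contra hgne
      have hlt : s < t := lt_of_le_of_ne hst (fun h => hgne (by rw [h]))
      -- find z in (s,t) with g z ≠ g t
      obtain ⟨k, hk1, hk2, hkne⟩ : ∃ k, s < r k ∧ r k < t ∧ g (r k) ≠ g t := by
        have hd : 0 < dist (g s) (g t) := dist_pos.mpr hgne
        obtain ⟨δ, hδ, h⟩ := Metric.continuousOn_iff.mp hg s hs _ hd
        obtain ⟨k, hk1, hk2⟩ := hrd s (min t (s+δ)) hs.1 (lt_min hlt (by linarith))
        rw [lt_min_iff] at hk2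
        refine ⟨k, hk1, hk2.1, fun hc => ?_⟩
        have := h (r k) ⟨hr0 k, by linarith [ht.2]⟩
          (by rw [Real.dist_eq, abs_lt]; constructor <;> linarith)
        rw [hc, dist_comm] at this
        exact lt_irrefl _ this
      have h1 : φ k s < φ k t := by
        have e0 : φ k s = 0 := by
          simp only [φ]
          rw [Icc_eq_empty (by linarith)]; simp
        have : dist (g (r k)) (g t) ≤ φ k t := Metric.dist_le_diam_of_mem (hbd.subset (hsub k t ht.2))
            ⟨r k, ⟨le_rfl, hk2.le⟩, rfl⟩ ⟨t, ⟨hk2.le, le_rfl⟩, rfl⟩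
        have := dist_pos.mpr hkne
        linarith
      have : Φ s < Φ t := Summable.tsum_lt_tsum (i := k)
        (fun j => mul_le_mul_of_nonneg_left (hmono j s t hst ht.2) (by positivity))
        (mul_lt_mul_of_pos_left h1 (by positivity)) (hsum s hs.2) (hsum t ht.2)
      linarith
    · intro he
      have : ∀ k, φ k s = φ k t := by
        intro k
        apply le_antisymm (hmono k s t hst ht.2)
        have := hstep k s hs t ht hst 0 le_rfl (fun u h1 h2 => by
          rw [hfib s hs t ht u h1 h2 he, dist_self])
        linarith
      simp [Φ, this]
  have h01 : Φ 0 < Φ 1 := by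
    apply lt_of_le_of_ne (hΦm 0 1 zero_le_one le_rfl)
    intro he
    exact hne ((hΦs 0 (by simp) 1 (by simp) zero_le_one).mp he)
  rw [hΦ0] at h01
  let ψ : unitInterval → unitInterval := fun t => ⟨Φ t / Φ 1, by
    have h1 := hΦm 0 t t.2.1 t.2.2
    have h2 := hΦm t 1 t.2.2 le_rfl
    rw [hΦ0] at h1
    exact ⟨by positivity, by rw [div_le_one h01]; exact h2⟩⟩
  have hψc : Continuous ψ := by
    apply Continuous.subtype_mk
    exact (continuousOn_iff_continuous_domRestrict.mp hΦc).div_const _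
  have hψ0 : ψ 0 = 0 := by apply Subtype.ext; simp [ψ, hΦ0]
  have hψ1 : ψ 1 = 1 := by apply Subtype.ext; simp [ψ, h01.ne']
  have hψs : Function.Surjective ψ := by
    intro y
    have := mem_range_of_exists_le_of_exists_ge hψc ⟨0, hψ0.le.trans y.2.1⟩ ⟨1, hψ1.ge.trans' (unitInterval.le_one')⟩
    exact this
  have hψg : ∀ s t, ψ s = ψ t ↔ g s = g t := by
    have : ∀ s t : unitInterval, ψ s = ψ t ↔ Φ s = Φ t := by
      intro s t
      rw [Subtype.ext_iff]
      exact div_left_inj' h01.ne'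
    intro s t
    rw [this]
    rcases le_total s t with h | h
    · exact hΦs s s.2 t t.2 h
    · rw [eq_comm, hΦs t t.2 s s.2 h, eq_comm]
  have hq : Topology.IsQuotientMap ψ := hψc.isClosedMap.isQuotientMap hψc hψs
  choose τ hτ using hψs
  have hcomp : (fun y => g (τ y)) ∘ ψ = fun t : unitInterval => g t := by
    funext t
    exact (hψg _ _).mp (hτ (ψ t))
  refine ⟨fun y => g (τ y), ?_, ?_, ?_, ?_, ?_⟩
  · rw [hq.continuous_iff, hcomp]
    exact continuousOn_iff_continuous_domRestrict.mp hg
  · intro a b hab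
    have := (hψg _ _).mpr hab
    rwa [hτ, hτ] at this
  · exact (hψg _ 0).mp (by rw [hτ, hψ0])
  · exact (hψg _ 1).mp (by rw [hτ, hψ1])
  · rintro _ ⟨y, rfl⟩
    exact ⟨τ y, (τ y).2, rfl⟩

theorem arc_of_joinedIn {X : Type*} [MetricSpace X] {A : Set X} {p q : X} (h : JoinedIn A p q)
    (hpq : p ≠ q) : ∃ α : ℝ → X, ContinuousOn α (Icc 0 1) ∧ InjOn α (Icc 0 1) ∧ α 0 = p ∧ α 1 = q ∧
      ∀ t ∈ Icc (0:ℝ) 1, α t ∈ A := by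
  obtain ⟨γ, hγ⟩ := h
  obtain ⟨g, hgc, hg0, hg1, hgr, hfib⟩ := arc_collapse γ.extend γ.continuous_extend
  rw [γ.extend_zero] at hg0
  rw [γ.extend_one] at hg1
  obtain ⟨h, hc, hi, h0, h1, hr⟩ := arc_param g hgc (by rw [hg0, hg1]; exact hpq) hfib
  refine ⟨fun t => h (projIcc 0 1 zero_le_one t), (hc.comp continuous_projIcc).continuousOn, ?_,
    ?_, ?_, ?_⟩
  · intro s hs t ht hst
    have := hi hst
    rw [projIcc_of_mem _ hs, projIcc_of_mem _ ht] at this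
    exact congrArg Subtype.val this
  · show h _ = p
    rw [projIcc_left]; exact h0.trans hg0
  · show h _ = q
    rw [projIcc_right]; exact h1.trans hg1
  · intro t ht
    obtain ⟨s, hs, hs2⟩ := hr ⟨projIcc 0 1 zero_le_one t, rfl⟩
    obtain ⟨u, hu, hu2⟩ := hgr s hs
    show h _ ∈ A
    rw [← hs2, hu2, γ.extend_apply hu]
    exact hγ _

theorem circle_of_loop {X : Type*} [MetricSpace X] {Z : Set X} (F : ℝ → X)
    (hc : ContinuousOn F (Icc 0 2)) (he : F 0 = F 2) (hi : InjOn F (Ico 0 2))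
    (hZ : ∀ t ∈ Ico (0:ℝ) 2, F t ∈ Z) : ∃ S : Set X, S ⊆ Z ∧ Nonempty (S ≃ₜ Circle) := by
  have : Fact (0 < (2:ℝ)) := ⟨two_pos⟩
  have hL := AddCircle.liftIco_zero_continuous (p := (2:ℝ)) he hc
  have hrep : ∀ x : AddCircle (2:ℝ), ∃ t ∈ Ico (0:ℝ) 2, (t : AddCircle (2:ℝ)) = x := by
    intro x
    have := (AddCircle.coe_image_Ico_eq (2:ℝ) 0)
    have hx : x ∈ (univ : Set (AddCircle (2:ℝ))) := mem_univ x
    rw [← this] at hx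
    obtain ⟨t, ht, h⟩ := hx
    exact ⟨t, by simpa using ht, h⟩
  have hinj : Function.Injective (AddCircle.liftIco (2:ℝ) 0 F) := by
    intro x y hxy
    obtain ⟨s, hs, rfl⟩ := hrep x
    obtain ⟨t, ht, rfl⟩ := hrep y
    rw [AddCircle.liftIco_zero_coe_apply hs, AddCircle.liftIco_zero_coe_apply ht] at hxy
    rw [hi hs ht hxy]
  have hemb := (hL.isClosedEmbedding hinj).isEmbedding
  refine ⟨range (AddCircle.liftIco (2:ℝ) 0 F), ?_, ⟨hemb.toHomeomorph.symm.trans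
    (AddCircle.homeomorphCircle (two_ne_zero))⟩⟩
  rintro _ ⟨x, rfl⟩
  obtain ⟨s, hs, rfl⟩ := hrep x
  rw [AddCircle.liftIco_zero_coe_apply hs]
  exact hZ s hs

theorem arcs_agree {X : Type*} [MetricSpace X] {Z : Set X}
    (hZ : ¬ ∃ S : Set X, S ⊆ Z ∧ Nonempty (S ≃ₜ Circle)) {p q : X} (α β : ℝ → X)
    (hαc : ContinuousOn α (Icc 0 1)) (hαi : InjOn α (Icc 0 1)) (hα0 : α 0 = p) (hα1 : α 1 = q)
    (hβc : ContinuousOn β (Icc 0 1)) (hβi : InjOn β (Icc 0 1)) (hβ0 : β 0 = p) (hβ1 : β 1 = q)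
    (hαZ : ∀ t ∈ Icc (0:ℝ) 1, α t ∈ Z) (hβZ : ∀ t ∈ Icc (0:ℝ) 1, β t ∈ Z) :
    α '' Icc 0 1 ⊆ β '' Icc 0 1 := by
  rintro _ ⟨z, hz, rfl⟩
  by_contra hzb
  apply hZ
  have hβcl : IsClosed (β '' Icc 0 1) := (isCompact_Icc.image_of_continuousOn hβc).isClosed
  have hBcl : IsClosed (Icc (0:ℝ) 1 ∩ α ⁻¹' (β '' Icc 0 1)) :=
    hαc.preimage_isClosed_of_isClosed isClosed_Icc hβcl
  have hBc : IsCompact (Icc (0:ℝ) 1 ∩ α ⁻¹' (β '' Icc 0 1)) :=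
    isCompact_Icc.of_isClosed_subset hBcl inter_subset_left
  have m0 : (0:ℝ) ∈ Icc (0:ℝ) 1 ∩ α ⁻¹' (β '' Icc 0 1) := ⟨by simp, ⟨0, by simp, by rw [hα0, hβ0]⟩⟩
  have m1 : (1:ℝ) ∈ Icc (0:ℝ) 1 ∩ α ⁻¹' (β '' Icc 0 1) := ⟨by simp, ⟨1, by simp, by rw [hα1, hβ1]⟩⟩
  obtain ⟨a, ha, ham⟩ := (hBc.inter_right (isClosed_Iic (a := z))).exists_isGreatest ⟨0, m0, hz.1⟩
  obtain ⟨b, hb, hbm⟩ := (hBc.inter_right (isClosed_Ici (a := z))).exists_isLeast ⟨1, m1, hz.2⟩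
  have haz : a < z := lt_of_le_of_ne ha.2 (fun h => hzb (h ▸ ha.1.2))
  have hzb' : z < b := lt_of_le_of_ne hb.2 (fun h => hzb (h ▸ hb.1.2))
  have hno : ∀ t, a < t → t < b → α t ∉ β '' Icc 0 1 := by
    intro t h1 h2 h3
    have hm : t ∈ Icc (0:ℝ) 1 ∩ α ⁻¹' (β '' Icc 0 1) :=
      ⟨⟨by linarith [ha.1.1.1], by linarith [hb.1.1.2]⟩, h3⟩
    rcases le_total t z with h | h
    · have := ham ⟨hm, h⟩; linarith
    · have := hbm ⟨hm, h⟩; linarith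
  obtain ⟨s, hs, hsa⟩ := ha.1.2
  obtain ⟨t, ht, htb⟩ := hb.1.2
  have hst : s ≠ t := by
    rintro rfl
    have := hαi ha.1.1 hb.1.1 (hsa.symm.trans htb)
    linarith
  have m1' : ∀ u ∈ Icc (0:ℝ) 1, a + (b - a) * u ∈ Icc (0:ℝ) 1 := by
    intro u hu
    have e1 := ha.1.1.1; have e2 := hb.1.1.2
    constructor <;> nlinarith [hu.1, hu.2]
  have m2' : ∀ u ∈ Icc (1:ℝ) 2, t + (s - t) * (u - 1) ∈ Icc (0:ℝ) 1 := by
    intro u hu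
    have := hu.1; have := hu.2; have := hs.1; have := hs.2; have := ht.1; have := ht.2
    constructor <;> nlinarith
  let F : ℝ → X := fun u => if u ≤ 1 then α (a + (b - a) * u) else β (t + (s - t) * (u - 1))
  have hF1 : ∀ u, u ≤ 1 → F u = α (a + (b - a) * u) := fun u hu => if_pos hu
  have hF2 : ∀ u, 1 ≤ u → F u = β (t + (s - t) * (u - 1)) := by
    intro u hu
    rcases eq_or_lt_of_le hu with h | h
    · rw [← h, hF1 1 le_rfl]; simp [htb]
    · exact if_neg (by linarith)
  apply circle_of_loop F
  · have c1 : ContinuousOn F (Icc 0 1) := by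
      apply ContinuousOn.congr (f := fun u => α (a + (b - a) * u))
      · exact hαc.comp (by fun_prop) m1'
      · intro u hu; exact hF1 u hu.2
    have c2 : ContinuousOn F (Icc 1 2) := by
      apply ContinuousOn.congr (f := fun u => β (t + (s - t) * (u - 1)))
      · exact hβc.comp (by fun_prop) m2'
      · intro u hu; exact hF2 u hu.1
    have := c1.union_of_isClosed c2 isClosed_Icc isClosed_Icc
    rwa [Icc_union_Icc_eq_Icc (by norm_num) (by norm_num)] at this
  · rw [hF1 0 (by norm_num), hF2 2 (by norm_num)]
    norm_num [hsa]
  · have hba : 0 < b - a := by linarith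
    have mixed : ∀ u ∈ Ico (0:ℝ) 2, ∀ v ∈ Ico (0:ℝ) 2, u ≤ 1 → 1 < v → F u ≠ F v := by
      intro u hu v hv hu1 hv1 he
      rw [hF1 u hu1, hF2 v hv1.le] at he
      have hm2 := m2' v ⟨hv1.le, hv.2.le⟩
      have hin : α (a + (b - a) * u) ∈ β '' Icc 0 1 := he ▸ mem_image_of_mem β hm2
      rcases eq_or_lt_of_le hu.1 with h0 | h0
      · rw [← h0] at he
        simp only [mul_zero, add_zero] at he
        rw [← hsa] at he
        have := hβi hs hm2 he
        have h3 : (s - t) * (2 - v) = 0 := by linarith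
        rcases mul_eq_zero.mp h3 with h | h
        · exact hst (by linarith)
        · linarith [hv.2]
      · rcases eq_or_lt_of_le hu1 with h1 | h1
        · rw [h1] at he
          simp only [mul_one, add_sub_cancel] at he
          rw [← htb] at he
          have := hβi ht hm2 he
          have h3 : (s - t) * (v - 1) = 0 := by linarith
          rcases mul_eq_zero.mp h3 with h | h
          · exact hst (by linarith)
          · linarith
        · exact hno _ (by nlinarith) (by nlinarith) hin
    intro u hu v hv he
    rcases le_or_gt u 1 with h1 | h1 <;> rcases le_or_gt v 1 with h2 | h2
    · rw [hF1 u h1, hF1 v h2] at he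
      have := hαi (m1' u ⟨hu.1, h1⟩) (m1' v ⟨hv.1, h2⟩) he
      exact mul_left_cancel₀ hba.ne' (by linarith)
    · exact absurd he (mixed u hu v hv h1 h2)
    · exact absurd he.symm (mixed v hv u hu h2 h1)
    · rw [hF2 u h1.le, hF2 v h2.le] at he
      have := hβi (m2' u ⟨h1.le, hu.2.le⟩) (m2' v ⟨h2.le, hv.2.le⟩) he
      have := mul_left_cancel₀ (sub_ne_zero.mpr hst) (by linarith : (s - t) * (u - 1) = (s - t) * (v - 1))
      linarith
  · intro u hu
    rcases le_total u 1 with h | h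
    · rw [hF1 u h]; exact hαZ _ (m1' u ⟨hu.1, h⟩)
    · rw [hF2 u h]; exact hβZ _ (m2' u ⟨h, hu.2.le⟩)

/-- In a set without circles, two points joined in `A` and in `B` lie in a connected
subset of `A ∩ B`. -/
theorem connected_inter_of_noCircle {X : Type*} [MetricSpace X] {Z A B : Set X}
    (hZ : ¬ ∃ S : Set X, S ⊆ Z ∧ Nonempty (S ≃ₜ Circle)) (hA : A ⊆ Z) (hB : B ⊆ Z)
    (hAp : IsPathConnected A) (hBp : IsPathConnected B) {p q : X} (hpA : p ∈ A) (hqA : q ∈ A)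
    (hpB : p ∈ B) (hqB : q ∈ B) : ∃ C ⊆ A ∩ B, IsPreconnected C ∧ p ∈ C ∧ q ∈ C := by
  by_cases hpq : p = q
  · subst hpq
    exact ⟨{p}, by simp [hpA, hpB], isPreconnected_singleton, rfl, rfl⟩
  obtain ⟨α, hαc, hαi, hα0, hα1, hαA⟩ := arc_of_joinedIn (hAp.joinedIn p hpA q hqA) hpq
  obtain ⟨β, hβc, hβi, hβ0, hβ1, hβB⟩ := arc_of_joinedIn (hBp.joinedIn p hpB q hqB) hpq
  have hsub := arcs_agree hZ α β hαc hαi hα0 hα1 hβc hβi hβ0 hβ1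
    (fun t ht => hA (hαA t ht)) (fun t ht => hB (hβB t ht))
  refine ⟨α '' Icc 0 1, ?_, isPreconnected_Icc.image _ hαc, ⟨0, by simp, hα0⟩, ⟨1, by simp, hα1⟩⟩
  rintro y hy
  obtain ⟨t, ht, rfl⟩ := hsub hy
  obtain ⟨u, hu, hu2⟩ := hy
  exact ⟨hu2 ▸ hαA u hu, hβB t ht⟩

theorem comps_le_four {X : Type*} [MetricSpace X] {K : Set X} (hconn : IsConnected K)
    (hlc : LocallyConnectedSpace K) {x : X} (hx : x ∈ K)
    (h : ∀ ε > 0, ∃ U V : Set X, IsClosed U ∧ IsClosed V ∧ K = U ∪ V ∧ U ⊆ Metric.ball x ε ∧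
      x ∉ V ∧ ∃ y₁ y₂ y₃ y₄ : X, U ∩ V ⊆ {y₁, y₂, y₃, y₄}) :
    Cardinal.mk (ConnectedComponents (K \ {x} : Set X)) ≤ 4 := by
  by_contra hcon
  push Not at hcon
  have h5 : (5 : Cardinal) ≤ Cardinal.mk (ConnectedComponents (K \ {x} : Set X)) := by
    have := Order.succ_le_of_lt hcon
    have e : Order.succ (4 : Cardinal) = 5 := by
      have := Cardinal.succ_natCast 4
      norm_num at this
      exact this
    rwa [e] at this
  have h5' : Cardinal.lift (Cardinal.mk (Fin 5)) ≤
      Cardinal.lift.{0} (Cardinal.mk (ConnectedComponents (K \ {x} : Set X))) := by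
    simpa using h5
  obtain ⟨c⟩ := Cardinal.lift_mk_le'.mp h5'
  have hrep : ∀ i, ∃ y : (K \ {x} : Set X), (y : ConnectedComponents (K \ {x} : Set X)) = c i :=
    fun i => ConnectedComponents.surjective_coe (c i)
  choose y hy using hrep
  have hsub : (K \ {x} : Set X) ⊆ K := sdiff_subset
  have hι : Topology.IsOpenEmbedding (Set.inclusion hsub) := by
    refine ⟨Topology.IsEmbedding.inclusion hsub, ?_⟩
    rw [range_inclusion]
    have : {k : K | (k : X) ∈ K \ {x}} = {(⟨x, hx⟩ : K)}ᶜ := by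
      ext k
      simp [Subtype.ext_iff]
    rw [this]
    exact isOpen_compl_singleton
  have hlcY : LocallyConnectedSpace (K \ {x} : Set X) := hι.locallyConnectedSpace
  have : PreconnectedSpace K := isPreconnected_iff_preconnectedSpace.mp hconn.isPreconnected
  have hclos : ∀ i, (⟨x, hx⟩ : K) ∈ closure (Set.inclusion hsub '' connectedComponent (y i)) := by
    intro i
    by_contra hn
    have hop : IsOpen (Set.inclusion hsub '' connectedComponent (y i)) :=
      hι.isOpenMap _ isOpen_connectedComponent
    have hcl : IsClosed (Set.inclusion hsub '' connectedComponent (y i)) := by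
      apply isClosed_of_closure_subset
      intro k hk
      have hkx : (k : X) ≠ x := by
        intro he
        apply hn
        have : k = ⟨x, hx⟩ := Subtype.ext he
        rwa [← this]
      have hkY : (k : X) ∈ K \ {x} := ⟨k.2, hkx⟩
      refine ⟨⟨k, hkY⟩, ?_, rfl⟩
      have hcc : IsClosed (connectedComponent (y i)) := isClosed_connectedComponent
      rw [← hcc.closure_eq, hι.isEmbedding.closure_eq_preimage_closure_image]
      exact hk
    rcases isClopen_iff.mp ⟨hcl, hop⟩ with h0 | h0
    · have : Set.inclusion hsub (y i) ∈ Set.inclusion hsub '' connectedComponent (y i) :=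
        mem_image_of_mem _ mem_connectedComponent
      rw [h0] at this
      exact this
    · apply hn
      apply subset_closure
      rw [h0]; trivial
  obtain ⟨ε, hε, hεy⟩ : ∃ ε > 0, ∀ i, ε ≤ dist (y i : X) x := by
    obtain ⟨i₀, hi₀⟩ := Finite.exists_min (fun i => dist (y i : X) x)
    exact ⟨dist (y i₀ : X) x, dist_pos.mpr (y i₀).2.2, hi₀⟩
  obtain ⟨U, V, hU, hV, hKUV, hUb, hxV, y₁, y₂, y₃, y₄, hUV⟩ := h ε hε
  have hz : ∀ i, ∃ z : (K \ {x} : Set X), z ∈ connectedComponent (y i) ∧ (z : X) ∈ U ∩ V := by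
    intro i
    have hpre : IsPreconnected (Subtype.val '' connectedComponent (y i)) :=
      isPreconnected_connectedComponent.image _ continuous_subtype_val.continuousOn
    have hsubK : Subtype.val '' connectedComponent (y i) ⊆ U ∪ V := by
      rw [← hKUV]
      rintro _ ⟨w, -, rfl⟩
      exact w.2.1
    have hmV : (Subtype.val '' connectedComponent (y i) ∩ V).Nonempty := by
      refine ⟨y i, ⟨y i, mem_connectedComponent, rfl⟩, ?_⟩
      have hyK : (y i : X) ∈ U ∪ V := by rw [← hKUV]; exact (y i).2.1
      rcases hyK with h | h
      · have := hUb h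
        rw [Metric.mem_ball] at this
        linarith [hεy i]
      · exact h
    have hmU : (Subtype.val '' connectedComponent (y i) ∩ U).Nonempty := by
      have hop : IsOpen (Subtype.val ⁻¹' Vᶜ : Set K) := hV.isOpen_compl.preimage continuous_subtype_val
      obtain ⟨k, hk1, ⟨w, hw, rfl⟩⟩ := mem_closure_iff.mp (hclos i) _ hop hxV
      refine ⟨w, ⟨w, hw, rfl⟩, ?_⟩
      have hwK : (w : X) ∈ U ∪ V := by rw [← hKUV]; exact w.2.1
      rcases hwK with h | h
      · exact h
      · exact absurd h hk1
    obtain ⟨_, ⟨z, hz, rfl⟩, hz2⟩ := isPreconnected_closed_iff.mp hpre U V hU hV hsubK hmU hmV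
    exact ⟨z, hz, hz2⟩
  choose z hz1 hz2 using hz
  classical
  have hmaps : ∀ i ∈ (Finset.univ : Finset (Fin 5)), (z i : X) ∈ ({y₁, y₂, y₃, y₄} : Finset X) := by
    intro i _
    have := hUV (hz2 i)
    simpa using this
  obtain ⟨i, -, j, -, hij, he⟩ := Finset.exists_ne_map_eq_of_card_lt_of_maps_to
    (lt_of_le_of_lt Finset.card_le_four (by simp)) hmaps
  have he' : z i = z j := Subtype.ext he
  apply hij
  apply c.injective
  rw [← hy i, ← hy j, ConnectedComponents.coe_eq_coe,
    connectedComponent_eq (hz1 i), connectedComponent_eq (hz1 j), he']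

/-- The translate `K + e`. -/
def cell (K : Set (ℝ × ℝ)) (e : ℤ × ℤ) : Set (ℝ × ℝ) := {y | y - coeZ2 e ∈ K}

/-- `K` is invariant with respect to the digit set `E` at scale `N`. -/
structure FS (N : ℕ) (E : Set (ℤ × ℤ)) (K : Set (ℝ × ℝ)) : Prop where
  two : 2 ≤ N
  dig : ∀ e ∈ E, 0 ≤ e.1 ∧ e.1 ≤ (N : ℤ) - 1 ∧ 0 ≤ e.2 ∧ e.2 ≤ (N : ℤ) - 1
  eq : ∀ y : ℝ × ℝ, y ∈ K ↔ ∃ e ∈ E, (N : ℝ) • y ∈ cell K e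

theorem coeZ2_add (a b : ℤ × ℤ) : coeZ2 (a + b) = coeZ2 a + coeZ2 b := by
  simp [coeZ2]

theorem FS.finite {N E K} (h : FS N E K) : E.Finite :=
  (Set.finite_Icc ((0, 0) : ℤ × ℤ) ((N : ℤ) - 1, (N : ℤ) - 1)).subset fun e he => by
    obtain ⟨h1, h2, h3, h4⟩ := h.dig e he
    exact ⟨⟨h1, h3⟩, ⟨h2, h4⟩⟩

theorem IsFractalSquare.fs {n D K} (h : IsFractalSquare n D K) : FS n D K := by
  obtain ⟨h2, hD, -, -, -, -, hK⟩ := h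
  refine ⟨h2, fun e he => ?_, fun y => ?_⟩
  · have := hD he
    exact ⟨this.1.1, this.2.1, this.1.2, this.2.2⟩
  · have hn : (n : ℝ) ≠ 0 := by positivity
    conv_lhs => rw [hK]
    simp only [mem_iUnion, mem_image, exists_prop, pieceMap, cell, mem_ofPred_eq]
    refine exists_congr fun e => and_congr_right fun he => ?_
    constructor
    · rintro ⟨x, hx, rfl⟩
      rw [smul_inv_smul₀ hn, add_sub_cancel_right]
      exact hx
    · intro hx
      exact ⟨_, hx, by rw [sub_add_cancel, inv_smul_smul₀ hn]⟩

theorem FS.comp {N L E D K} (h : FS N E K) (h' : FS L D K) :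
    FS (N * L) {f | ∃ e ∈ E, ∃ d ∈ D, f = (L : ℤ) • e + d} K := by
  refine ⟨?_, ?_, ?_⟩
  · nlinarith [h.two, h'.two]
  · rintro _ ⟨e, he, d, hd, rfl⟩
    obtain ⟨a1, a2, a3, a4⟩ := h.dig e he
    obtain ⟨b1, b2, b3, b4⟩ := h'.dig d hd
    have hL : (0 : ℤ) ≤ L := by positivity
    simp only [Prod.fst_add, Prod.snd_add, Prod.smul_fst, Prod.smul_snd, smul_eq_mul]
    push_cast
    refine ⟨?_, ?_, ?_, ?_⟩ <;> nlinarith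
  · intro y
    rw [h.eq]
    simp only [cell, mem_ofPred_eq]
    have key : ∀ e d : ℤ × ℤ, ((N * L : ℕ) : ℝ) • y - coeZ2 ((L : ℤ) • e + d) =
        (L : ℝ) • ((N : ℝ) • y - coeZ2 e) - coeZ2 d := by
      intro e d
      ext <;> simp [coeZ2] <;> ring
    constructor
    · rintro ⟨e, he, hy⟩
      obtain ⟨d, hd, hy⟩ := (h'.eq _).mp hy
      refine ⟨_, ⟨e, he, d, hd, rfl⟩, ?_⟩
      rw [key]; exact hy
    · rintro ⟨_, ⟨e, he, d, hd, rfl⟩, hy⟩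
      rw [key] at hy
      exact ⟨e, he, (h'.eq _).mpr ⟨d, hd, hy⟩⟩

theorem FS.square {N E K} (h : FS N E K) (hc : IsCompact K) :
    ∀ y ∈ K, 0 ≤ y.1 ∧ y.1 ≤ 1 ∧ 0 ≤ y.2 ∧ y.2 ≤ 1 := by
  intro y hy
  have hne : K.Nonempty := ⟨y, hy⟩
  have hN : (2 : ℝ) ≤ N := by exact_mod_cast h.two
  have dig : ∀ e ∈ E, (0:ℝ) ≤ e.1 ∧ (e.1:ℝ) ≤ N - 1 ∧ (0:ℝ) ≤ e.2 ∧ (e.2:ℝ) ≤ N - 1 := by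
    intro e he
    obtain ⟨a1, a2, a3, a4⟩ := h.dig e he
    exact ⟨by exact_mod_cast a1, by exact_mod_cast a2, by exact_mod_cast a3, by exact_mod_cast a4⟩
  refine ⟨?_, ?_, ?_, ?_⟩
  · obtain ⟨m, hm, hmin⟩ := hc.exists_isMinOn hne continuous_fst.continuousOn
    obtain ⟨e, he, hme⟩ := (h.eq m).mp hm
    have h1 := hmin hme
    have h2 := hmin hy
    simp [coeZ2] at h1 h2
    nlinarith [dig e he]
  · obtain ⟨m, hm, hmin⟩ := hc.exists_isMaxOn hne continuous_fst.continuousOn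
    obtain ⟨e, he, hme⟩ := (h.eq m).mp hm
    have h1 := hmin hme
    have h2 := hmin hy
    simp [coeZ2] at h1 h2
    nlinarith [dig e he]
  · obtain ⟨m, hm, hmin⟩ := hc.exists_isMinOn hne continuous_snd.continuousOn
    obtain ⟨e, he, hme⟩ := (h.eq m).mp hm
    have h1 := hmin hme
    have h2 := hmin hy
    simp [coeZ2] at h1 h2
    nlinarith [dig e he]
  · obtain ⟨m, hm, hmin⟩ := hc.exists_isMaxOn hne continuous_snd.continuousOn
    obtain ⟨e, he, hme⟩ := (h.eq m).mp hm
    have h1 := hmin hme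
    have h2 := hmin hy
    simp [coeZ2] at h1 h2
    nlinarith [dig e he]

theorem isClosed_cell {K} (hc : IsClosed K) (e : ℤ × ℤ) : IsClosed (cell K e) :=
  hc.preimage (by fun_prop : Continuous fun y : ℝ × ℝ => y - coeZ2 e)

/-- Auxiliary relation for the theorem of Hata. -/
def HataRel (n : ℕ) (K : Set (ℝ × ℝ)) (p q : ℝ × ℝ) : Prop :=
  ∃ T : (∀ a b : ℝ × ℝ, Path a b) → Path p q,
    (∀ (F G : ∀ a b : ℝ × ℝ, Path a b) (c : ℝ), (∀ a ∈ K, ∀ b ∈ K, ∀ t, dist (F a b t) (G a b t) ≤ c) →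
      ∀ t, dist (T F t) (T G t) ≤ c / n) ∧
    (∀ (F : ∀ a b : ℝ × ℝ, Path a b) (c : ℝ), (∀ a ∈ K, ∀ b ∈ K, ∀ t, Metric.infDist (F a b t) K ≤ c) →
      ∀ t, Metric.infDist (T F t) K ≤ c / n)

theorem HataRel.trans {n K p q r} (h : HataRel n K p q) (h' : HataRel n K q r) : HataRel n K p r := by
  obtain ⟨T, hT1, hT2⟩ := h
  obtain ⟨S, hS1, hS2⟩ := h'
  refine ⟨fun F => (T F).trans (S F), ?_, ?_⟩
  · intro F G c h t
    rw [Path.trans_apply, Path.trans_apply]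
    split_ifs
    · exact hT1 F G c h _
    · exact hS1 F G c h _
  · intro F c h t
    rw [Path.trans_apply]
    split_ifs
    · exact hT2 F c h _
    · exact hS2 F c h _

theorem HataRel.of_piece {n D K p q} (h : FS n D K) (hc : IsCompact K) {d : ℤ × ℤ} (hd : d ∈ D)
    (hp : (n : ℝ) • p ∈ cell K d) (hq : (n : ℝ) • q ∈ cell K d) : HataRel n K p q := by
  have hn : (0 : ℝ) < n := by have := h.two; positivity
  let φ : ℝ × ℝ → ℝ × ℝ := pieceMap n d
  have hφ : Continuous φ := by
    show Continuous fun y => (n : ℝ)⁻¹ • (y + coeZ2 d)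
    fun_prop
  have hφi : ∀ y : ℝ × ℝ, φ ((n : ℝ) • y - coeZ2 d) = y := by
    intro y
    simp only [φ, pieceMap]
    rw [sub_add_cancel, inv_smul_smul₀ hn.ne']
  have hφK : ∀ y ∈ K, φ y ∈ K := by
    intro y hy
    rw [h.eq]
    refine ⟨d, hd, ?_⟩
    simp only [cell, mem_ofPred_eq, φ, pieceMap]
    rw [smul_inv_smul₀ hn.ne', add_sub_cancel_right]; exact hy
  have hφd : ∀ a b, dist (φ a) (φ b) = dist a b / n := by
    intro a b
    simp only [φ, pieceMap]
    rw [dist_smul₀, dist_add_right, norm_inv, Real.norm_of_nonneg hn.le]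
    ring
  refine ⟨fun F => ((F ((n : ℝ) • p - coeZ2 d) ((n : ℝ) • q - coeZ2 d)).map hφ).cast
    (hφi p).symm (hφi q).symm, ?_, ?_⟩
  · intro F G c h t
    simp only [Path.cast_coe, Path.map_coe, Function.comp]
    rw [hφd]
    have := h _ hp _ hq t
    gcongr
  · intro F c h t
    simp only [Path.cast_coe, Path.map_coe, Function.comp]
    have := h _ hp _ hq t
    obtain ⟨k, hk, hke⟩ := hc.exists_infDist_eq_dist ⟨_, hp⟩ (F ((n : ℝ) • p - coeZ2 d) ((n : ℝ) • q - coeZ2 d) t)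
    refine (Metric.infDist_le_dist_of_mem (hφK k hk)).trans ?_
    rw [hφd, ← hke]
    gcongr

theorem HataRel.all {n D K} (h : FS n D K) (hc : IsCompact K) (hK : IsPreconnected K) {p q}
    (hp : p ∈ K) (hq : q ∈ K) : HataRel n K p q := by
  by_contra hn
  let P : ℤ × ℤ → Set (ℝ × ℝ) := fun d => {y | (n : ℝ) • y ∈ cell K d}
  have hPc : ∀ d, IsClosed (P d) := fun d =>
    (isClosed_cell hc.isClosed d).preimage (by fun_prop : Continuous fun y : ℝ × ℝ => (n : ℝ) • y)
  have hPK : ∀ d ∈ D, P d ⊆ K := fun d hd y hy => (h.eq y).mpr ⟨d, hd, hy⟩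
  let U := ⋃ d ∈ {d ∈ D | ∃ y ∈ P d, HataRel n K p y}, P d
  let V := ⋃ d ∈ {d ∈ D | ∃ y ∈ P d, ¬ HataRel n K p y}, P d
  have hU : IsClosed U := (h.finite.subset (sep_subset _ _)).isClosed_biUnion fun d _ => hPc d
  have hV : IsClosed V := (h.finite.subset (sep_subset _ _)).isClosed_biUnion fun d _ => hPc d
  have hUm : ∀ y ∈ K, HataRel n K p y → y ∈ U := by
    intro y hy hr
    obtain ⟨d, hd, hyd⟩ := (h.eq y).mp hy
    exact mem_biUnion (⟨hd, y, hyd, hr⟩ : d ∈ {d ∈ D | ∃ y ∈ P d, HataRel n K p y}) hyd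
  have hVm : ∀ y ∈ K, ¬ HataRel n K p y → y ∈ V := by
    intro y hy hr
    obtain ⟨d, hd, hyd⟩ := (h.eq y).mp hy
    exact mem_biUnion (⟨hd, y, hyd, hr⟩ : d ∈ {d ∈ D | ∃ y ∈ P d, ¬ HataRel n K p y}) hyd
  have hpp : HataRel n K p p := by
    obtain ⟨d, hd, hyd⟩ := (h.eq p).mp hp
    exact HataRel.of_piece h hc hd hyd hyd
  obtain ⟨y, hyK, hyU, hyV⟩ := isPreconnected_closed_iff.mp hK U V hU hV
    (fun y hy => by
      by_cases hr : HataRel n K p y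
      · exact Or.inl (hUm y hy hr)
      · exact Or.inr (hVm y hy hr)) ⟨p, hp, hUm p hp hpp⟩ ⟨q, hq, hVm q hq hn⟩
  simp only [U, V, mem_iUnion, mem_ofPred_eq, exists_prop] at hyU hyV
  obtain ⟨d, ⟨hd, a, had, ha⟩, hyd⟩ := hyU
  obtain ⟨e, ⟨he, b, hbe, hb⟩, hye⟩ := hyV
  exact hb ((ha.trans (HataRel.of_piece h hc hd had hyd)).trans (HataRel.of_piece h hc he hye hbe))

theorem FS.isPathConnected {n D K} (h : FS n D K) (hc : IsCompact K) (hK : IsConnected K) :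
    IsPathConnected K := by
  have hn2 : (2 : ℝ) ≤ n := by exact_mod_cast h.two
  have hT : ∀ p q : ℝ × ℝ, ∃ T : (∀ a b : ℝ × ℝ, Path a b) → Path p q, p ∈ K → q ∈ K →
    (∀ (F G : ∀ a b : ℝ × ℝ, Path a b) (c : ℝ), (∀ a ∈ K, ∀ b ∈ K, ∀ t, dist (F a b t) (G a b t) ≤ c) →
      ∀ t, dist (T F t) (T G t) ≤ c / n) ∧
    (∀ (F : ∀ a b : ℝ × ℝ, Path a b) (c : ℝ), (∀ a ∈ K, ∀ b ∈ K, ∀ t, Metric.infDist (F a b t) K ≤ c) →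
      ∀ t, Metric.infDist (T F t) K ≤ c / n) := by
    intro p q
    by_cases hpq : p ∈ K ∧ q ∈ K
    · obtain ⟨T, hT⟩ := HataRel.all h hc hK.isPreconnected hpq.1 hpq.2
      exact ⟨T, fun _ _ => hT⟩
    · exact ⟨fun F => F p q, fun hp hq => absurd ⟨hp, hq⟩ hpq⟩
  choose T hT using hT
  let F0 : ∀ a b : ℝ × ℝ, Path a b := fun a b =>
    { toFun := fun t => AffineMap.lineMap a b (t : ℝ)
      continuous_toFun := by
        simp only [AffineMap.lineMap_apply]
        fun_prop
      source' := by simp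
      target' := by simp }
  let F : ℕ → ∀ a b : ℝ × ℝ, Path a b := fun k => Nat.rec F0 (fun _ G a b => T a b G) k
  have hFs : ∀ k a b, F (k+1) a b = T a b (F k) := fun k a b => rfl
  let M := Metric.diam K
  have hM0 : 0 ≤ M := Metric.diam_nonneg
  have hM : ∀ a ∈ K, ∀ b ∈ K, dist a b ≤ M := fun a ha b hb => Metric.dist_le_diam_of_mem hc.isBounded ha hb
  have hinf : ∀ k, ∀ a ∈ K, ∀ b ∈ K, ∀ t, Metric.infDist (F k a b t) K ≤ M / n ^ k := by
    intro k
    induction k with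
    | zero =>
      intro a ha b hb t
      refine (Metric.infDist_le_dist_of_mem ha).trans ?_
      show dist (AffineMap.lineMap a b (t : ℝ)) a ≤ _
      rw [dist_lineMap_left, Real.norm_of_nonneg t.2.1]
      have := hM a ha b hb
      have h1 := t.2.2
      simp only [pow_zero, div_one]
      nlinarith [dist_nonneg (x := a) (y := b), t.2.1]
    | succ k ih =>
      intro a ha b hb t
      rw [hFs]
      refine ((hT a b ha hb).2 _ _ ih t).trans (le_of_eq ?_)
      rw [pow_succ, div_div]
  have hstep : ∀ k, ∀ a ∈ K, ∀ b ∈ K, ∀ t, dist (F k a b t) (F (k+1) a b t) ≤ (3 * M) / n ^ k := by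
    intro k
    induction k with
    | zero =>
      intro a ha b hb t
      obtain ⟨y, hy, hye⟩ := hc.exists_infDist_eq_dist ⟨a, ha⟩ (F 0 a b t)
      obtain ⟨z, hz, hze⟩ := hc.exists_infDist_eq_dist ⟨a, ha⟩ (F 1 a b t)
      have h1 := hinf 0 a ha b hb t
      have h2 := hinf 1 a ha b hb t
      have h3 := hM y hy z hz
      have h4 : M / n ^ 1 ≤ M := by
        rw [pow_one]; exact div_le_self hM0 (by linarith)
      have h5 := dist_triangle4_right (F 0 a b t) (F 1 a b t) y z
      simp only [pow_zero, div_one, zero_add] at *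
      rw [hye] at h1
      rw [hze] at h2
      linarith
    | succ k ih =>
      intro a ha b hb t
      rw [hFs, hFs (k+1)]
      refine ((hT a b ha hb).1 _ _ _ ih t).trans (le_of_eq ?_)
      rw [pow_succ, div_div]
  obtain ⟨p, hp⟩ := hK.nonempty
  refine ⟨p, hp, fun {q} hq => ?_⟩
  let f : ℕ → C(unitInterval, ℝ × ℝ) := fun k => (F k p q).toContinuousMap
  have hcau : CauchySeq f := by
    apply cauchySeq_of_le_geometric (1 / 2 : ℝ) (3 * M) (by norm_num)
    intro k
    rw [ContinuousMap.dist_le (by positivity)]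
    intro t
    refine (hstep k p hp q hq t).trans ?_
    rw [div_eq_mul_inv, one_div, inv_pow]
    gcongr
  obtain ⟨g, hg⟩ := cauchySeq_tendsto_of_complete hcau
  have hgt : ∀ t, Filter.Tendsto (fun k => f k t) Filter.atTop (nhds (g t)) := fun t =>
    ((continuous_eval_const t).tendsto g).comp hg
  have hg0 : g 0 = p := by
    refine tendsto_nhds_unique (hgt 0) ?_
    have : (fun k => f k 0) = fun _ => p := by
      funext k; exact (F k p q).source
    rw [this]; exact tendsto_const_nhds
  have hg1 : g 1 = q := by
    refine tendsto_nhds_unique (hgt 1) ?_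
    have : (fun k => f k 1) = fun _ => q := by
      funext k; exact (F k p q).target
    rw [this]; exact tendsto_const_nhds
  refine ⟨⟨g, hg0, hg1⟩, fun t => ?_⟩
  show g t ∈ K
  rw [hc.isClosed.mem_iff_infDist_zero ⟨p, hp⟩]
  apply le_antisymm _ Metric.infDist_nonneg
  have h1 : Filter.Tendsto (fun k => Metric.infDist (f k t) K) Filter.atTop (nhds (Metric.infDist (g t) K)) :=
    ((Metric.continuous_infDist_pt K).tendsto _).comp (hgt t)
  have h2 : Filter.Tendsto (fun k : ℕ => M * (1 / (n:ℝ)) ^ k) Filter.atTop (nhds (M * 0)) := by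
    apply Filter.Tendsto.const_mul
    apply tendsto_pow_atTop_nhds_zero_of_lt_one (by positivity)
    rw [div_lt_one (by linarith)]; linarith
  rw [mul_zero] at h2
  refine le_of_tendsto_of_tendsto' h1 h2 fun k => ?_
  refine (hinf k p hp q hq t).trans (le_of_eq ?_)
  rw [one_div, inv_pow, div_eq_mul_inv]

/-- `Z` contains no topological circle. -/
def NoCircle {X : Type*} [TopologicalSpace X] (Z : Set X) : Prop :=
  ¬ ∃ S : Set X, S ⊆ Z ∧ Nonempty (S ≃ₜ Circle)

theorem NoCircle.preimage {X Y : Type*} [TopologicalSpace X] [TopologicalSpace Y] {Z : Set Y}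
    (hZ : NoCircle Z) (e : X ≃ₜ Y) : NoCircle (e ⁻¹' Z) := by
  rintro ⟨S, hS, ⟨φ⟩⟩
  exact hZ ⟨e '' S, image_subset_iff.mpr hS, ⟨(e.image S).symm.trans φ⟩⟩

/-- The standing facts about a fractal square which is a dendrite. -/
structure Good (K : Set (ℝ × ℝ)) : Prop where
  compact : IsCompact K
  pc : IsPathConnected K
  nc : NoCircle K
  deep : ∀ B : ℕ, ∃ N E, B ≤ N ∧ FS N E K

theorem Good.square {K} (h : Good K) : ∀ y ∈ K, 0 ≤ y.1 ∧ y.1 ≤ 1 ∧ 0 ≤ y.2 ∧ y.2 ≤ 1 := by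
  obtain ⟨N, E, -, hE⟩ := h.deep 0
  exact hE.square h.compact

theorem Good.cell_square {K} (h : Good K) {e : ℤ × ℤ} {y} (hy : y ∈ cell K e) :
    (e.1 : ℝ) ≤ y.1 ∧ y.1 ≤ e.1 + 1 ∧ (e.2 : ℝ) ≤ y.2 ∧ y.2 ≤ e.2 + 1 := by
  have := h.square _ hy
  simp only [coeZ2, Prod.fst_sub, Prod.snd_sub] at this
  obtain ⟨a, b, c, d⟩ := this
  exact ⟨by linarith, by linarith, by linarith, by linarith⟩

theorem FS.swap {N E K} (h : FS N E K) :
    FS N (Prod.swap ⁻¹' E) (Prod.swap ⁻¹' K) := by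
  refine ⟨h.two, fun e he => ?_, fun y => ?_⟩
  · obtain ⟨a, b, c, d⟩ := h.dig _ he
    exact ⟨c, d, a, b⟩
  · rw [mem_preimage, h.eq]
    constructor
    · rintro ⟨e, he, hy⟩
      exact ⟨e.swap, by simpa using he, hy⟩
    · rintro ⟨e, he, hy⟩
      exact ⟨e.swap, he, hy⟩

theorem Good.swap {K} (h : Good K) : Good (Prod.swap ⁻¹' K) := by
  have e : Prod.swap ⁻¹' K = Prod.swap '' K := by
    rw [image_swap_eq_preimage_swap]
  refine ⟨?_, ?_, h.nc.preimage (Homeomorph.prodComm ℝ ℝ), fun B => ?_⟩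
  · rw [e]; exact h.compact.image continuous_swap
  · rw [e]; exact h.pc.image continuous_swap
  · obtain ⟨N, E, hB, hE⟩ := h.deep B
    exact ⟨N, _, hB, hE.swap⟩

theorem Good.cell_pc {K} (h : Good K) (e : ℤ × ℤ) : IsPathConnected (cell K e) := by
  have : cell K e = (fun y => y + coeZ2 e) '' K := by
    ext y
    constructor
    · intro hy; exact ⟨_, hy, sub_add_cancel _ _⟩
    · rintro ⟨z, hz, rfl⟩
      simpa [cell] using hz
  rw [this]
  exact h.pc.image (by fun_prop)

theorem FS.conn {N E K} (hE : FS N E K) (h : Good K) {A B : Set (ℝ × ℝ)}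
    (hA : ∀ y ∈ A, ∃ e ∈ E, y ∈ cell K e) (hB : ∀ y ∈ B, ∃ e ∈ E, y ∈ cell K e)
    (hAp : IsPathConnected A) (hBp : IsPathConnected B) {p q} (hpA : p ∈ A) (hqA : q ∈ A)
    (hpB : p ∈ B) (hqB : q ∈ B) : ∃ C ⊆ A ∩ B, IsPreconnected C ∧ p ∈ C ∧ q ∈ C := by
  have hN : (N : ℝ) ≠ 0 := by have := hE.two; positivity
  have key : ∀ y : ℝ × ℝ, (N : ℝ)⁻¹ • y ∈ K ↔ ∃ e ∈ E, y ∈ cell K e := by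
    intro y; rw [hE.eq, smul_inv_smul₀ hN]
  refine connected_inter_of_noCircle
    (h.nc.preimage (Homeomorph.smulOfNeZero (N : ℝ)⁻¹ (inv_ne_zero hN))) ?_ ?_ hAp hBp hpA hqA hpB hqB
  · intro y hy; exact (key y).mpr (hA y hy)
  · intro y hy; exact (key y).mpr (hB y hy)

theorem Good.digit {K N E} (h : Good K) (hE : FS N E K) {c : ℝ} (hc : c = 0 ∨ c = 1) {j : ℤ} {y : ℝ}
    (hy0 : 0 < y) (hy1 : y < 1) (hK : (c, (j + y) / N) ∈ K) :
    ∃ e ∈ E, e.2 = j ∧ (c = 0 → e.1 = 0) ∧ (c, y) ∈ K := by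
  have hN : (N : ℝ) ≠ 0 := by have := hE.two; positivity
  obtain ⟨e, he, hy⟩ := (hE.eq _).mp hK
  have hs := h.square _ hy
  have hd := hE.dig e he
  have e2 : e.2 = j := by
    simp [coeZ2, mul_div_cancel₀ _ hN] at hs
    have h1 : (e.2 : ℝ) < j + 1 := by linarith
    have h2 : (j : ℝ) < e.2 + 1 := by linarith
    norm_cast at h1 h2
    omega
  have hs1 := hs.1
  have hs2 := hs.2.1
  simp [coeZ2] at hs1 hs2
  have e3 : (N : ℝ) * c - e.1 = c ∧ (c = 0 → e.1 = 0) := by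
    rcases hc with rfl | rfl
    · simp at hs1
      norm_cast at hs1
      have : e.1 = 0 := by omega
      simp [this]
    · simp at hs2
      have h1 : (N : ℝ) ≤ e.1 + 1 := by linarith
      norm_cast at h1
      have : e.1 = N - 1 := by omega
      simp [this]
  refine ⟨e, he, e2, e3.2, ?_⟩
  have : (N : ℝ) • ((c, (j + y) / N) : ℝ × ℝ) - coeZ2 e = (c, y) := by
    ext
    · simp [coeZ2, e3.1]
    · simp [coeZ2, e2, mul_div_cancel₀ _ hN]
  rwa [cell, mem_ofPred_eq, this] at hy

theorem Good.full_side {K} (h : Good K) {c a b : ℝ} (hc : c = 0 ∨ c = 1) (hab : a < b)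
    (hK : ∀ y, a ≤ y → y ≤ b → (c, y) ∈ K) : ∀ y, 0 ≤ y → y ≤ 1 → (c, y) ∈ K := by
  have hin : ∀ y ∈ Ioo (0 : ℝ) 1, (c, y) ∈ K := by
    rintro y ⟨hy0, hy1⟩
    obtain ⟨B, hB⟩ := exists_nat_gt (2 / (b - a))
    obtain ⟨N, E, hBN, hE⟩ := h.deep B
    have hN : (0 : ℝ) < N := by have := hE.two; positivity
    have hNB : 2 < (N : ℝ) * (b - a) := by
      rw [← div_lt_iff₀ (by linarith)]
      exact hB.trans_le (by exact_mod_cast hBN)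
    have h1 := Int.lt_floor_add_one (a * N)
    have h2 := Int.floor_le (a * N)
    obtain ⟨_, _, _, _, hh⟩ := h.digit hE hc (j := ⌊a * N⌋ + 1) hy0 hy1 (by
      apply hK
      · rw [le_div_iff₀ hN]; push_cast; linarith
      · rw [div_le_iff₀ hN]; push_cast; nlinarith)
    exact hh
  intro y hy0 hy1
  have hcl : IsClosed {y : ℝ | (c, y) ∈ K} :=
    h.compact.isClosed.preimage (by fun_prop : Continuous fun y : ℝ => (c, y))
  have : closure (Ioo (0 : ℝ) 1) ⊆ {y : ℝ | (c, y) ∈ K} := hcl.closure_subset_iff.mpr hin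
  rw [closure_Ioo (by norm_num)] at this
  exact this ⟨hy0, hy1⟩

theorem Good.not_sides {K} (h : Good K) (h0 : ∀ y, 0 ≤ y → y ≤ 1 → ((0 : ℝ), y) ∈ K)
    (h1 : ∀ y, 0 ≤ y → y ≤ 1 → ((1 : ℝ), y) ∈ K) : False := by
  obtain ⟨N, E, -, hE⟩ := h.deep 0
  have hN : (2 : ℝ) ≤ N := by exact_mod_cast hE.two
  obtain ⟨e, he, e2, e1, -⟩ := h.digit hE (Or.inl rfl) (j := 0) (y := 1/2) (by norm_num) (by norm_num)
    (h0 _ (by positivity) (by rw [div_le_iff₀ (by linarith)]; push_cast; linarith))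
  obtain ⟨f, hf, f2, f1, -⟩ := h.digit hE (Or.inl rfl) (j := 1) (y := 1/2) (by norm_num) (by norm_num)
    (h0 _ (by positivity) (by rw [div_le_iff₀ (by linarith)]; push_cast; linarith))
  have e1 := e1 rfl
  have f1 := f1 rfl
  have he0 : e = (0, 0) := Prod.ext e1 e2
  have hf0 : f = (0, 1) := Prod.ext f1 f2
  subst he0 hf0
  have k00 := h0 0 le_rfl (by norm_num)
  have k01 := h0 1 (by norm_num) le_rfl
  have k10 := h1 0 le_rfl (by norm_num)
  have k11 := h1 1 (by norm_num) le_rfl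
  obtain ⟨C, hC, hCc, hp, hq⟩ := hE.conn h (fun y hy => ⟨_, he, hy⟩) (fun y hy => ⟨_, hf, hy⟩)
    (h.cell_pc _) (h.cell_pc _) (p := (0, 1)) (q := (1, 1))
    (by simpa [cell, coeZ2] using k01) (by simpa [cell, coeZ2] using k11)
    (by simpa [cell, coeZ2] using (show (0 : ℝ × ℝ) ∈ K from k00)) (by simpa [cell, coeZ2] using k10)
  have hC1 : ∀ s, 0 ≤ s → s ≤ 1 → ((s, 1) : ℝ × ℝ) ∈ C := by
    intro s hs0 hs1
    have := (hCc.image Prod.fst continuous_fst.continuousOn).ordConnected.out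
      ⟨_, hp, rfl⟩ ⟨_, hq, rfl⟩ (⟨hs0, hs1⟩ : s ∈ Icc (0:ℝ) 1)
    obtain ⟨z, hz, rfl⟩ := this
    have hz1 := h.cell_square (hC hz).1
    have hz2 := h.cell_square (hC hz).2
    have : z = (z.1, 1) := by
      ext
      · rfl
      · simp at hz1 hz2 ⊢; linarith
    rwa [← this]
  have ht : ∀ s, 0 ≤ s → s ≤ 1 → ((s, 1) : ℝ × ℝ) ∈ K := by
    intro s a b
    simpa [cell, coeZ2] using (hC (hC1 s a b)).1
  have hb : ∀ s, 0 ≤ s → s ≤ 1 → ((s, 0) : ℝ × ℝ) ∈ K := by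
    intro s a b
    simpa [cell, coeZ2] using (hC (hC1 s a b)).2
  have seg : ∀ a b c d : ℝ, a ≤ b → c ≤ d → IsPathConnected (Icc a b ×ˢ Icc c d) := by
    intro a b c d hab hcd
    exact ((convex_Icc a b).prod (convex_Icc c d)).isPathConnected
      ⟨(a, c), ⟨le_rfl, hab⟩, ⟨le_rfl, hcd⟩⟩
  obtain ⟨C', hC', hCc', hp', hq'⟩ := connected_inter_of_noCircle h.nc
    (A := (Icc 0 0 ×ˢ Icc 0 1) ∪ (Icc 0 1 ×ˢ Icc 1 1)) (B := (Icc 0 1 ×ˢ Icc 0 0) ∪ (Icc 1 1 ×ˢ Icc 0 1))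
    (p := (0, 0)) (q := (1, 1))
    (by
      rintro ⟨s, t⟩ (⟨⟨a, b⟩, ⟨c, d⟩⟩ | ⟨⟨a, b⟩, ⟨c, d⟩⟩) <;> simp at a b c d
      · obtain rfl : s = 0 := le_antisymm b a
        exact h0 _ c d
      · obtain rfl : t = 1 := le_antisymm d c
        exact ht _ a b)
    (by
      rintro ⟨s, t⟩ (⟨⟨a, b⟩, ⟨c, d⟩⟩ | ⟨⟨a, b⟩, ⟨c, d⟩⟩) <;> simp at a b c d
      · obtain rfl : t = 0 := le_antisymm d c
        exact hb _ a b
      · obtain rfl : s = 1 := le_antisymm b a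
        exact h1 _ c d)
    ((seg _ _ _ _ le_rfl zero_le_one).union (seg _ _ _ _ zero_le_one le_rfl) ⟨(0, 1), by simp, by simp⟩)
    ((seg _ _ _ _ zero_le_one le_rfl).union (seg _ _ _ _ le_rfl zero_le_one) ⟨(1, 0), by simp, by simp⟩)
    (by simp) (by simp) (by simp) (by simp)
  obtain ⟨z, hz, hz2⟩ := (hCc'.image Prod.fst continuous_fst.continuousOn).ordConnected.out
      ⟨_, hp', rfl⟩ ⟨_, hq', rfl⟩ (⟨by norm_num, by norm_num⟩ : (1/2 : ℝ) ∈ Icc (0:ℝ) 1)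
  obtain ⟨ha, hb⟩ := hC' hz
  rcases ha with ⟨⟨a1, a2⟩, ⟨a3, a4⟩⟩ | ⟨⟨a1, a2⟩, ⟨a3, a4⟩⟩ <;>
  rcases hb with ⟨⟨b1, b2⟩, ⟨b3, b4⟩⟩ | ⟨⟨b1, b2⟩, ⟨b3, b4⟩⟩ <;> simp at * <;> linarith

theorem Good.sub_fst {K N E} (h : Good K) (hE : FS N E K) {e f : ℤ × ℤ} (he : e ∈ E) (hf : f ∈ E)
    (hef : e.1 + 1 = f.1) : (cell K e ∩ cell K f).Subsingleton := by
  by_contra hns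
  rw [Set.not_subsingleton_iff] at hns
  obtain ⟨p, hp, q, hq, hpq⟩ := hns
  have hfst : ∀ y ∈ cell K e ∩ cell K f, y.1 = f.1 := by
    intro y hy
    have h1 := h.cell_square hy.1
    have h2 := h.cell_square hy.2
    have : (e.1 : ℝ) + 1 = f.1 := by exact_mod_cast hef
    linarith
  obtain ⟨C, hC, hCc, hpC, hqC⟩ := hE.conn h (fun y hy => ⟨_, he, hy⟩) (fun y hy => ⟨_, hf, hy⟩)
    (h.cell_pc _) (h.cell_pc _) hp.1 hq.1 hp.2 hq.2
  have main : ∀ p ∈ C, ∀ q ∈ C, p.2 < q.2 → False := by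
    intro p hpC q hqC hlt
    have hseg : ∀ t, p.2 ≤ t → t ≤ q.2 → ((f.1 : ℝ), t) ∈ cell K e ∩ cell K f := by
      intro t h1 h2
      obtain ⟨z, hz, rfl⟩ := (hCc.image Prod.snd continuous_snd.continuousOn).ordConnected.out
        ⟨_, hpC, rfl⟩ ⟨_, hqC, rfl⟩ (⟨h1, h2⟩ : t ∈ Icc p.2 q.2)
      rw [← hfst z (hC hz)]
      exact hC hz
    refine h.not_sides (h.full_side (Or.inl rfl) (a := p.2 - f.2) (b := q.2 - f.2) (by linarith) ?_)
      (h.full_side (Or.inr rfl) (a := p.2 - e.2) (b := q.2 - e.2) (by linarith) ?_)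
    · intro y h1 h2
      have := (hseg (y + f.2) (by linarith) (by linarith)).2
      simpa [cell, coeZ2] using this
    · intro y h1 h2
      have := (hseg (y + e.2) (by linarith) (by linarith)).1
      simpa [cell, coeZ2, ← hef] using this
  rcases lt_trichotomy p.2 q.2 with hl | hl | hl
  · exact main p hpC q hqC hl
  · exact hpq (Prod.ext ((hfst p hp).trans (hfst q hq).symm) hl)
  · exact main q hqC p hpC hl

theorem Good.near {K} (h : Good K) {e f : ℤ × ℤ} {y} (hy : y ∈ cell K e) (hy' : y ∈ cell K f) :
    f.1 ≤ e.1 + 1 ∧ e.1 ≤ f.1 + 1 ∧ f.2 ≤ e.2 + 1 ∧ e.2 ≤ f.2 + 1 := by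
  obtain ⟨a1, a2, a3, a4⟩ := h.cell_square hy
  obtain ⟨b1, b2, b3, b4⟩ := h.cell_square hy'
  refine ⟨?_, ?_, ?_, ?_⟩
  · exact_mod_cast b1.trans a2
  · exact_mod_cast a1.trans b2
  · exact_mod_cast b3.trans a4
  · exact_mod_cast a3.trans b4

theorem Good.sub {K N E} (h : Good K) (hE : FS N E K) {e f : ℤ × ℤ} (he : e ∈ E) (hf : f ∈ E)
    (hef : e ≠ f) : (cell K e ∩ cell K f).Subsingleton := by
  intro p hp q hq
  have hn := h.near hp.1 hp.2
  by_cases h1 : e.1 = f.1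
  · have h2 : e.2 ≠ f.2 := fun h2 => hef (Prod.ext h1 h2)
    apply Prod.swap_injective
    rcases (by omega : e.2 + 1 = f.2 ∨ f.2 + 1 = e.2) with h3 | h3
    · exact h.swap.sub_fst hE.swap (e := e.swap) (f := f.swap) he hf h3 ⟨hp.1, hp.2⟩ ⟨hq.1, hq.2⟩
    · exact h.swap.sub_fst hE.swap (e := f.swap) (f := e.swap) hf he h3 ⟨hp.2, hp.1⟩ ⟨hq.2, hq.1⟩
  · rcases (by omega : e.1 + 1 = f.1 ∨ f.1 + 1 = e.1) with h3 | h3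
    · exact h.sub_fst hE he hf h3 hp hq
    · exact h.sub_fst hE hf he h3 hp.symm hq.symm

theorem Good.tri {K N E} (h : Good K) (hE : FS N E K) {w w' w'' : ℤ × ℤ} (hw : w ∈ E) (hw' : w' ∈ E)
    (hw'' : w'' ∈ E) (h1 : w ≠ w') (h2 : w ≠ w'') {p r} (hp : p ∈ cell K w ∩ cell K w')
    (hr : r ∈ cell K w ∩ cell K w'') (hn : (cell K w' ∩ cell K w'').Nonempty) : p = r := by
  obtain ⟨C, hC, hCc, hpC, hrC⟩ := hE.conn h (A := cell K w) (B := cell K w' ∪ cell K w'')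
    (fun y hy => ⟨_, hw, hy⟩) (fun y hy => hy.elim (fun hy => ⟨_, hw', hy⟩) (fun hy => ⟨_, hw'', hy⟩))
    (h.cell_pc _) ((h.cell_pc _).union (h.cell_pc _) hn) hp.1 hr.1 (Or.inl hp.2) (Or.inr hr.2)
  have hsub : C ⊆ {p, r} := by
    intro y hy
    rcases (hC hy).2 with h3 | h3
    · exact Or.inl (h.sub hE hw hw' h1 ⟨(hC hy).1, h3⟩ hp)
    · exact Or.inr (h.sub hE hw hw'' h2 ⟨(hC hy).1, h3⟩ hr)
  exact (((Set.finite_singleton r).insert p).countable.isTotallyDisconnected) C hsub hCc hpC hrC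

/-- Occurring difference vectors of touching cells. -/
def Occ (K : Set (ℝ × ℝ)) (δ : ℤ × ℤ) : Prop :=
  δ ≠ 0 ∧ ∃ N E, FS N E K ∧ ∃ e ∈ E, e + δ ∈ E ∧ (cell K e ∩ cell K (e + δ)).Nonempty

theorem cell_add {K} {e t : ℤ × ℤ} {y : ℝ × ℝ} : y ∈ cell K (e + t) ↔ y - coeZ2 t ∈ cell K e := by
  simp only [cell, mem_ofPred_eq, coeZ2_add]
  rw [show y - (coeZ2 e + coeZ2 t) = y - coeZ2 t - coeZ2 e by abel]

theorem Occ.touch {K δ} (h : Occ K δ) (w : ℤ × ℤ) : (cell K w ∩ cell K (w + δ)).Nonempty := by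
  obtain ⟨-, N, E, -, e, -, -, y, h1, h2⟩ := h
  refine ⟨y - coeZ2 (e - w), ?_, ?_⟩
  · rw [← cell_add, add_sub_cancel]; exact h1
  · rw [← cell_add, show w + δ + (e - w) = e + δ by abel]; exact h2

theorem Occ.neg {K δ} (h : Occ K δ) : Occ K (-δ) := by
  obtain ⟨h0, N, E, hE, e, he, hf, y, h1, h2⟩ := h
  refine ⟨neg_ne_zero.mpr h0, N, E, hE, e + δ, hf, ?_, y, h2, ?_⟩
  · simpa using he
  · simpa using h1

theorem Good.occ {K N E} (hE : FS N E K) {e f : ℤ × ℤ} (he : e ∈ E) (hf : f ∈ E)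
    (hef : e ≠ f) (hn : (cell K e ∩ cell K f).Nonempty) : Occ K (f - e) :=
  ⟨sub_ne_zero.mpr hef.symm, N, E, hE, e, he, by simpa using hf, by simpa using hn⟩

theorem Good.occ_near {K δ} (h : Good K) (ho : Occ K δ) :
    δ ≠ 0 ∧ -1 ≤ δ.1 ∧ δ.1 ≤ 1 ∧ -1 ≤ δ.2 ∧ δ.2 ≤ 1 := by
  obtain ⟨y, h1, h2⟩ := ho.touch 0
  have := h.near h1 h2
  simp at this
  exact ⟨ho.1, by omega, by omega, by omega, by omega⟩

theorem Good.corner {K} (h : Good K) (h1 : Occ K (1, 1)) (h2 : Occ K (1, -1)) :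
    (0, 0) ∈ K ∧ (1, 1) ∈ K ∧ (1, 0) ∈ K ∧ (0, 1) ∈ K := by
  obtain ⟨y, a1, a2⟩ := h1.touch 0
  obtain ⟨z, b1, b2⟩ := h2.touch 0
  have ha1 := h.cell_square a1
  have ha2 := h.cell_square a2
  have hb1 := h.cell_square b1
  have hb2 := h.cell_square b2
  simp at ha1 ha2 hb1 hb2
  have hy : y = (1, 1) := Prod.ext (by linarith) (by linarith)
  have hz : z = (1, 0) := Prod.ext (by linarith) (by linarith)
  subst hy hz
  simp [cell, coeZ2] at a1 a2 b1 b2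
  exact ⟨a2, a1, b1, b2⟩

theorem Good.not_occ {K} (h : Good K) (h1 : Occ K (1, 1)) (h2 : Occ K (1, -1)) :
    ¬ Occ K (1, 0) ∧ ¬ Occ K (0, 1) := by
  obtain ⟨k00, k11, k10, k01⟩ := h.corner h1 h2
  constructor
  · rintro ⟨-, N, E, hE, e, he, hf, -⟩
    have := h.sub hE he hf (by simp)
      (show coeZ2 (e + (1, 0)) ∈ _ from ⟨by simpa [cell, coeZ2] using k10, by simpa [cell, coeZ2] using (show (0 : ℝ × ℝ) ∈ K from k00)⟩)
      (show coeZ2 (e + (1, 1)) ∈ _ from ⟨by simpa [cell, coeZ2] using k11, by simpa [cell, coeZ2] using k01⟩)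
    simp [coeZ2] at this
  · rintro ⟨-, N, E, hE, e, he, hf, -⟩
    have := h.sub hE he hf (by simp)
      (show coeZ2 (e + (0, 1)) ∈ _ from ⟨by simpa [cell, coeZ2] using k01, by simpa [cell, coeZ2] using (show (0 : ℝ × ℝ) ∈ K from k00)⟩)
      (show coeZ2 (e + (1, 1)) ∈ _ from ⟨by simpa [cell, coeZ2] using k11, by simpa [cell, coeZ2] using k10⟩)
    simp [coeZ2] at this

/-- Abstract touching configuration of cells around a point `x`. -/
structure Conf {X : Type*} (c : ℤ × ℤ → Set X) (F : Set (ℤ × ℤ)) (x : X) (Dir : ℤ × ℤ → Prop) :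
    Prop where
  sub : ∀ f ∈ F, ∀ g ∈ F, f ≠ g → (c f ∩ c g).Subsingleton
  dir : ∀ f ∈ F, ∀ g ∈ F, f ≠ g → (c f ∩ c g).Nonempty → Dir (g - f)
  touch : ∀ δ, Dir δ → ∀ w, (c w ∩ c (w + δ)).Nonempty
  neg : ∀ δ, Dir δ → Dir (-δ)
  nz : ∀ δ, Dir δ → δ ≠ 0
  tri : ∀ w ∈ F, ∀ w' ∈ F, ∀ w'' ∈ F, w ≠ w' → w ≠ w'' → ∀ p ∈ c w ∩ c w', ∀ r ∈ c w ∩ c w'',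
    (c w' ∩ c w'').Nonempty → p = r
  far : ∀ w ∈ F, x ∈ c w → ∀ w' ∈ F, x ∈ c w' → w ≠ w' → ∀ g ∈ F, x ∉ c g → ∀ g' ∈ F, x ∉ c g' →
    (c w ∩ c g).Nonempty → (c w' ∩ c g').Nonempty → ¬ (c g ∩ c g').Nonempty

/-- The touching points between the cell `f` at `x` and the cell `g` away from `x`. -/
def tt {X : Type*} (c : ℤ × ℤ → Set X) (F : Set (ℤ × ℤ)) (x : X) (f g : ℤ × ℤ) : Set X :=
  {y | f ∈ F ∧ x ∈ c f ∧ g ∈ F ∧ x ∉ c g ∧ y ∈ c f ∧ y ∈ c g}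

section conf

variable {X : Type*} {c : ℤ × ℤ → Set X} {F : Set (ℤ × ℤ)} {x : X} {Dir : ℤ × ℤ → Prop}

theorem Conf.tt_union (h : Conf c F x Dir) {w w' g g' : ℤ × ℤ} (hg : g = g' ∨ Dir (g' - g)) :
    (tt c F x w g ∪ tt c F x w' g').Subsingleton := by
  have hne : ∀ w g : ℤ × ℤ, x ∈ c w → x ∉ c g → w ≠ g := by
    rintro w _ h1 h2 rfl; exact h2 h1
  have one : ∀ w g, (tt c F x w g).Subsingleton := by
    rintro w g p ⟨a1, a2, a3, a4, a5, a6⟩ q ⟨_, _, _, _, b5, b6⟩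
    exact h.sub w a1 g a3 (hne _ _ a2 a4) ⟨a5, a6⟩ ⟨b5, b6⟩
  have key : ∀ p ∈ tt c F x w g, ∀ q ∈ tt c F x w' g', p = q := by
    rintro p ⟨a1, a2, a3, a4, a5, a6⟩ q ⟨b1, b2, b3, b4, b5, b6⟩
    have hgg : (c g ∩ c g').Nonempty := by
      rcases hg with rfl | hg
      · exact ⟨p, a6, a6⟩
      · have := h.touch _ hg g
        rwa [add_sub_cancel] at this
    by_cases hw : w = w'
    · subst hw
      exact h.tri w a1 g a3 g' b3 (hne _ _ a2 a4) (hne _ _ a2 b4) p ⟨a5, a6⟩ q ⟨b5, b6⟩ hgg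
    · exact absurd hgg (h.far w a1 a2 w' b1 b2 hw g a3 a4 g' b3 b4 ⟨p, a5, a6⟩ ⟨q, b5, b6⟩)
  rintro p (hp | hp) q (hq | hq)
  · exact one _ _ hp hq
  · exact key p hp q hq
  · exact (key q hq p hp).symm
  · exact one _ _ hp hq

theorem Conf.tt_empty (h : Conf c F x Dir) {w w' g : ℤ × ℤ} (hw : w' ∈ F) (hxw : x ∈ c w')
    (hww : w ≠ w') (hg : Dir (g - w')) (y : X) : y ∉ tt c F x w g := by
  rintro ⟨a1, a2, a3, a4, a5, a6⟩
  have ht := h.touch _ hg w'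
  rw [add_sub_cancel] at ht
  have hne : w ≠ g := by rintro rfl; exact a4 a2
  have := h.tri w a1 w' hw g a3 hww hne x ⟨a2, hxw⟩ y ⟨a5, a6⟩ ht
  exact a4 (this ▸ a6)

theorem four_of_slots {B s₁ s₂ s₃ s₄ : Set X} (x : X) (h : B ⊆ s₁ ∪ s₂ ∪ s₃ ∪ s₄)
    (h₁ : s₁.Subsingleton) (h₂ : s₂.Subsingleton) (h₃ : s₃.Subsingleton) (h₄ : s₄.Subsingleton) :
    ∃ y₁ y₂ y₃ y₄ : X, B ⊆ {y₁, y₂, y₃, y₄} := by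
  have key : ∀ s : Set X, s.Subsingleton → ∃ y, ∀ z ∈ s, z = y := by
    intro s hs
    rcases s.eq_empty_or_nonempty with rfl | ⟨y, hy⟩
    · exact ⟨x, by simp⟩
    · exact ⟨y, fun z hz => hs hz hy⟩
  obtain ⟨y₁, k₁⟩ := key _ h₁
  obtain ⟨y₂, k₂⟩ := key _ h₂
  obtain ⟨y₃, k₃⟩ := key _ h₃
  obtain ⟨y₄, k₄⟩ := key _ h₄
  refine ⟨y₁, y₂, y₃, y₄, fun z hz => ?_⟩
  rcases h hz with ((hz | hz) | hz) | hz
  · simp [k₁ z hz]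
  · simp [k₂ z hz]
  · simp [k₃ z hz]
  · simp [k₄ z hz]

/-- The boundary of the union of the cells at `x`. -/
def bdry (c : ℤ × ℤ → Set X) (F : Set (ℤ × ℤ)) (x : X) : Set X := {y | ∃ f g, y ∈ tt c F x f g}

theorem Conf.tt_dir (h : Conf c F x Dir) {f g : ℤ × ℤ} {y} (hy : y ∈ tt c F x f g) : Dir (g - f) := by
  obtain ⟨a1, a2, a3, a4, a5, a6⟩ := hy
  exact h.dir f a1 g a3 (by rintro rfl; exact a4 a2) ⟨y, a5, a6⟩

theorem Conf.two_aux (h : Conf c F x Dir) {u v w : ℤ × ℤ}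
    (hS : ∀ δ, Dir δ → δ = u ∨ δ = -u ∨ δ = v ∨ δ = -v) (hu : Dir u)
    (hw : x ∈ c w) (hwu : x ∈ c (w + u)) (hP : ∀ f ∈ F, x ∈ c f → f = w ∨ f = w + u) :
    ∃ y₁ y₂ y₃ y₄ : X, bdry c F x ⊆ {y₁, y₂, y₃, y₄} := by
  refine four_of_slots x (s₁ := tt c F x w (w - u) ∪ tt c F x w (w - u))
    (s₂ := tt c F x (w + u) (w + u + u) ∪ tt c F x (w + u) (w + u + u))
    (s₃ := tt c F x w (w + v) ∪ tt c F x (w + u) (w + u + v))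
    (s₄ := tt c F x w (w - v) ∪ tt c F x (w + u) (w + u - v)) ?_ (h.tt_union (Or.inl rfl))
    (h.tt_union (Or.inl rfl)) (h.tt_union (Or.inr ?_)) (h.tt_union (Or.inr ?_))
  · rintro y ⟨f, g, hy⟩
    have hd := h.tt_dir hy
    have hg4 := hy.2.2.2.1
    rcases hP f hy.1 hy.2.1 with rfl | rfl
    · rcases hS _ hd with e | e | e | e <;> rw [sub_eq_iff_eq_add'] at e <;> subst e
      · exact absurd hwu hg4
      · rw [← sub_eq_add_neg] at hy
        simp only [mem_union]; tauto
      · simp only [mem_union]; tauto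
      · rw [← sub_eq_add_neg] at hy
        simp only [mem_union]; tauto
    · rcases hS _ hd with e | e | e | e <;> rw [sub_eq_iff_eq_add'] at e <;> subst e
      · simp only [mem_union]; tauto
      · rw [add_neg_cancel_right] at hg4
        exact absurd hw hg4
      · simp only [mem_union]; tauto
      · rw [← sub_eq_add_neg] at hy
        simp only [mem_union]; tauto
  · convert hu using 1; abel
  · convert hu using 1; abel

theorem Conf.two (h : Conf c F x Dir) {u v : ℤ × ℤ}
    (hS : ∀ δ, Dir δ → δ = u ∨ δ = -u ∨ δ = v ∨ δ = -v)
    (hind : ∀ a b, Dir a → Dir b → ¬ Dir (a - b)) :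
    ∃ y₁ y₂ y₃ y₄ : X, bdry c F x ⊆ {y₁, y₂, y₃, y₄} := by
  by_cases hne : ∃ w ∈ F, x ∈ c w
  swap
  · refine ⟨x, x, x, x, ?_⟩
    rintro y ⟨f, g, hy⟩
    exact absurd ⟨f, hy.1, hy.2.1⟩ hne
  obtain ⟨w, hwF, hw⟩ := hne
  by_cases h1 : ∃ w' ∈ F, x ∈ c w' ∧ w ≠ w'
  swap
  · push Not at h1
    refine four_of_slots x (s₁ := tt c F x w (w + u) ∪ tt c F x w (w + u))
      (s₂ := tt c F x w (w - u) ∪ tt c F x w (w - u))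
      (s₃ := tt c F x w (w + v) ∪ tt c F x w (w + v))
      (s₄ := tt c F x w (w - v) ∪ tt c F x w (w - v)) ?_ (h.tt_union (Or.inl rfl))
      (h.tt_union (Or.inl rfl)) (h.tt_union (Or.inl rfl)) (h.tt_union (Or.inl rfl))
    rintro y ⟨f, g, hy⟩
    obtain rfl := h1 f hy.1 hy.2.1
    rcases hS _ (h.tt_dir hy) with e | e | e | e <;> rw [sub_eq_iff_eq_add'] at e <;> subst e <;>
      simp only [mem_union, sub_eq_add_neg] <;> tauto
  obtain ⟨w', hwF', hw', hww⟩ := h1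
  have hd := h.dir w hwF w' hwF' hww ⟨x, hw, hw'⟩
  have hP : ∀ f ∈ F, x ∈ c f → f = w ∨ f = w' := by
    intro f hf hx
    by_contra! hc
    have d1 := h.dir w hwF f hf hc.1.symm ⟨x, hw, hx⟩
    have d2 := h.dir w' hwF' f hf hc.2.symm ⟨x, hw', hx⟩
    apply hind _ _ d1 hd
    convert d2 using 1; abel
  have hd' := h.neg _ hd
  have hP' : ∀ f ∈ F, x ∈ c f → f = w' ∨ f = w := fun f a b => (hP f a b).symm
  have hS' : ∀ δ, Dir δ → δ = v ∨ δ = -v ∨ δ = u ∨ δ = -u := by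
    intro δ hδ
    have := hS δ hδ
    tauto
  rcases hS _ hd with e | e | e | e
  · rw [e] at hd
    rw [sub_eq_iff_eq_add'] at e; subst e
    exact h.two_aux hS hd hw hw' hP
  · rw [e, neg_neg] at hd'
    have e' : w = w' + u := by rw [sub_eq_iff_eq_add'] at e; rw [e]; abel
    rw [e'] at hP' hw
    exact h.two_aux hS hd' hw' hw hP'
  · rw [e] at hd
    rw [sub_eq_iff_eq_add'] at e; subst e
    exact h.two_aux hS' hd hw hw' hP
  · rw [e, neg_neg] at hd'
    have e' : w = w' + v := by rw [sub_eq_iff_eq_add'] at e; rw [e]; abel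
    rw [e'] at hP' hw
    exact h.two_aux hS' hd' hw' hw hP'

/-- The six hexagonal directions. -/
def hexset (i j : ℤ) : Prop :=
  -1 ≤ i ∧ i ≤ 1 ∧ -1 ≤ j ∧ j ≤ 1 ∧ -1 ≤ i - j ∧ i - j ≤ 1 ∧ (i ≠ 0 ∨ j ≠ 0)

/-- `Dir` is the hexagonal direction set spanned by `a` and `b`. -/
structure Hex (Dir : ℤ × ℤ → Prop) (a b : ℤ × ℤ) : Prop where
  mem : ∀ δ, Dir δ ↔ ∃ i j, hexset i j ∧ δ = i • a + j • b
  ind : ∀ i j : ℤ, i • a + j • b = 0 → i = 0 ∧ j = 0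

variable {a b : ℤ × ℤ}

theorem Hex.swap (h : Hex Dir a b) : Hex Dir b a := by
  refine ⟨fun δ => ?_, fun i j e => ?_⟩
  · rw [h.mem]
    constructor
    · rintro ⟨i, j, h1, rfl⟩
      exact ⟨j, i, by unfold hexset at *; omega, by abel⟩
    · rintro ⟨i, j, h1, rfl⟩
      exact ⟨j, i, by unfold hexset at *; omega, by abel⟩
  · rw [add_comm] at e
    exact (h.ind _ _ e).symm

theorem Hex.rot (h : Hex Dir a b) : Hex Dir (a + b) (-a) := by
  refine ⟨fun δ => ?_, fun i j e => ?_⟩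
  · rw [h.mem]
    constructor
    · rintro ⟨i, j, h1, rfl⟩
      exact ⟨j, j - i, by unfold hexset at *; omega, by module⟩
    · rintro ⟨i, j, h1, rfl⟩
      exact ⟨i - j, i, by unfold hexset at *; omega, by module⟩
  · have := h.ind (i - j) i (by rw [← e]; module)
    omega

theorem Hex.of (h : Hex Dir a b) {δ : ℤ × ℤ} (i j : ℤ) (e : δ = i • a + j • b)
    (hh : hexset i j := by unfold hexset; norm_num) : Dir δ := (h.mem δ).mpr ⟨i, j, hh, e⟩

theorem Hex.cases (h : Hex Dir a b) {δ : ℤ × ℤ} (hd : Dir δ) :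
    δ = a ∨ δ = a + b ∨ δ = b ∨ δ = -a ∨ δ = -a - b ∨ δ = -b := by
  obtain ⟨i, j, hh, rfl⟩ := (h.mem δ).mp hd
  unfold hexset at hh
  have : (i = 1 ∧ j = 0) ∨ (i = 1 ∧ j = 1) ∨ (i = 0 ∧ j = 1) ∨ (i = -1 ∧ j = 0) ∨ (i = -1 ∧ j = -1) ∨
    (i = 0 ∧ j = -1) := by omega
  rcases this with ⟨rfl, rfl⟩ | ⟨rfl, rfl⟩ | ⟨rfl, rfl⟩ | ⟨rfl, rfl⟩ | ⟨rfl, rfl⟩ | ⟨rfl, rfl⟩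
  · left; module
  · right; left; module
  · right; right; left; module
  · right; right; right; left; module
  · right; right; right; right; left; module
  · right; right; right; right; right; module

theorem Conf.nb (h : Conf c F x Dir) (hx : Hex Dir a b) {f g : ℤ × ℤ} {y} (hy : y ∈ tt c F x f g) :
    g = f + a ∨ g = f + a + b ∨ g = f + b ∨ g = f - a ∨ g = f - a - b ∨ g = f - b := by
  have e : g = f + (g - f) := by abel
  rcases hx.cases (h.tt_dir hy) with hd | hd | hd | hd | hd | hd <;> rw [hd] at e
  · left; exact e
  · right; left; rw [e]; abel
  · right; right; left; exact e
  · right; right; right; left; rw [e]; abel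
  · right; right; right; right; left; rw [e]; abel
  · right; right; right; right; right; rw [e]; abel

theorem Conf.hex1 (h : Conf c F x Dir) (hx : Hex Dir a b) {w : ℤ × ℤ}
    (hP : ∀ f ∈ F, x ∈ c f → f = w) : ∃ y₁ y₂ y₃ y₄ : X, bdry c F x ⊆ {y₁, y₂, y₃, y₄} := by
  refine four_of_slots x (s₁ := tt c F x w (w + a) ∪ tt c F x w (w + a + b))
      (s₂ := tt c F x w (w + b) ∪ tt c F x w (w - a))
      (s₃ := tt c F x w (w - a - b) ∪ tt c F x w (w - b))
      (s₄ := ∅) ?_ (h.tt_union (Or.inr ?_))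
      (h.tt_union (Or.inr ?_)) (h.tt_union (Or.inr ?_)) subsingleton_empty
  · rintro y ⟨f, g, hy⟩
    obtain rfl := hP f hy.1 hy.2.1
    rcases h.nb hx hy with rfl | rfl | rfl | rfl | rfl | rfl <;> simp only [mem_union] <;> tauto
  · exact hx.of 0 1 (by module)
  · exact hx.of (-1) (-1) (by module)
  · exact hx.of 1 0 (by module)

theorem Hex.ne_a (hx : Hex Dir a b) (w : ℤ × ℤ) : w ≠ w + a := by
  intro e
  have := hx.ind 1 0 (by simpa using e)
  omega

theorem Hex.ne_b (hx : Hex Dir a b) (w : ℤ × ℤ) : w ≠ w + b := hx.swap.ne_a w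

theorem Hex.ne_ab (hx : Hex Dir a b) (w : ℤ × ℤ) : w ≠ w + a + b := by
  rw [add_assoc]; exact hx.rot.ne_a w

theorem Conf.hex2 (h : Conf c F x Dir) (hx : Hex Dir a b) {w : ℤ × ℤ} (hw : w ∈ F) (hxw : x ∈ c w)
    (hw2 : w + a ∈ F) (hxw2 : x ∈ c (w + a))
    (hP : ∀ f ∈ F, x ∈ c f → f = w ∨ f = w + a) :
    ∃ y₁ y₂ y₃ y₄ : X, bdry c F x ⊆ {y₁, y₂, y₃, y₄} := by
  refine four_of_slots x (s₁ := tt c F x w (w + b) ∪ tt c F x w (w - a))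
      (s₂ := tt c F x w (w - a - b) ∪ tt c F x w (w - a - b))
      (s₃ := tt c F x (w + a) (w + a + a) ∪ tt c F x (w + a) (w + a + a + b))
      (s₄ := tt c F x (w + a) (w + a - b) ∪ tt c F x (w + a) (w + a - b)) ?_ (h.tt_union (Or.inr ?_))
      (h.tt_union (Or.inl rfl)) (h.tt_union (Or.inr ?_)) (h.tt_union (Or.inl rfl))
  · rintro y ⟨f, g, hy⟩
    have hg4 := hy.2.2.2.1
    rcases hP f hy.1 hy.2.1 with rfl | rfl
    · rcases h.nb hx hy with rfl | rfl | rfl | rfl | rfl | rfl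
      · exact absurd hxw2 hg4
      · exact absurd hy (h.tt_empty hw2 hxw2 (hx.ne_a _) (hx.of 0 1 (by module)) y)
      · simp only [mem_union]; tauto
      · simp only [mem_union]; tauto
      · simp only [mem_union]; tauto
      · exact absurd hy (h.tt_empty hw2 hxw2 (hx.ne_a _) (hx.of (-1) (-1) (by module)) y)
    · rcases h.nb hx hy with rfl | rfl | rfl | rfl | rfl | rfl
      · simp only [mem_union]; tauto
      · simp only [mem_union]; tauto
      · exact absurd hy (h.tt_empty hw hxw (hx.ne_a _).symm (hx.of 1 1 (by module)) y)
      · rw [add_sub_cancel_right] at hg4; exact absurd hxw hg4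
      · exact absurd hy (h.tt_empty hw hxw (hx.ne_a _).symm (hx.of 0 (-1) (by module)) y)
      · simp only [mem_union]; tauto
  · exact hx.of (-1) (-1) (by module)
  · exact hx.of 0 1 (by module)

theorem Conf.hex3 (h : Conf c F x Dir) (hx : Hex Dir a b) {w : ℤ × ℤ} (hw : w ∈ F) (hxw : x ∈ c w)
    (hw2 : w + a ∈ F) (hxw2 : x ∈ c (w + a)) (hw3 : w + a + b ∈ F) (hxw3 : x ∈ c (w + a + b))
    (hP : ∀ f ∈ F, x ∈ c f → f = w ∨ f = w + a ∨ f = w + a + b) :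
    ∃ y₁ y₂ y₃ y₄ : X, bdry c F x ⊆ {y₁, y₂, y₃, y₄} := by
  refine four_of_slots x (s₁ := tt c F x w (w - a) ∪ tt c F x w (w - a - b))
      (s₂ := tt c F x (w + a) (w + a + a) ∪ tt c F x (w + a) (w + a + a))
      (s₃ := tt c F x (w + a) (w + a - b) ∪ tt c F x (w + a) (w + a - b))
      (s₄ := tt c F x (w + a + b) (w + a + b + b) ∪ tt c F x (w + a + b) (w + a + b + a + b)) ?_
      (h.tt_union (Or.inr ?_))
      (h.tt_union (Or.inl rfl)) (h.tt_union (Or.inl rfl)) (h.tt_union (Or.inr ?_))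
  · rintro y ⟨f, g, hy⟩
    have hg4 := hy.2.2.2.1
    rcases hP f hy.1 hy.2.1 with rfl | rfl | rfl
    · rcases h.nb hx hy with rfl | rfl | rfl | rfl | rfl | rfl
      · exact absurd hxw2 hg4
      · exact absurd hxw3 hg4
      · exact absurd hy (h.tt_empty hw3 hxw3 (hx.ne_ab _) (hx.of (-1) 0 (by module)) y)
      · simp only [mem_union]; tauto
      · simp only [mem_union]; tauto
      · exact absurd hy (h.tt_empty hw2 hxw2 (hx.ne_a _) (hx.of (-1) (-1) (by module)) y)
    · rcases h.nb hx hy with rfl | rfl | rfl | rfl | rfl | rfl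
      · simp only [mem_union]; tauto
      · exact absurd hy (h.tt_empty hw3 hxw3 (hx.ne_b _) (hx.of 1 0 (by module)) y)
      · exact absurd hxw3 hg4
      · rw [add_sub_cancel_right] at hg4; exact absurd hxw hg4
      · exact absurd hy (h.tt_empty hw hxw (hx.ne_a _).symm (hx.of 0 (-1) (by module)) y)
      · simp only [mem_union]; tauto
    · rcases h.nb hx hy with rfl | rfl | rfl | rfl | rfl | rfl
      · exact absurd hy (h.tt_empty hw2 hxw2 (hx.ne_b _).symm (hx.of 1 1 (by module)) y)
      · simp only [mem_union]; tauto
      · simp only [mem_union]; tauto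
      · exact absurd hy (h.tt_empty hw hxw (hx.ne_ab _).symm (hx.of 0 1 (by module)) y)
      · rw [show w + a + b - a - b = w by abel] at hg4; exact absurd hxw hg4
      · rw [add_sub_cancel_right] at hg4; exact absurd hxw2 hg4
  · exact hx.of 0 (-1) (by module)
  · exact hx.of 1 0 (by module)

theorem Conf.hex3' (h : Conf c F x Dir) (hx : Hex Dir a b) {w : ℤ × ℤ} (hw : w ∈ F) (hxw : x ∈ c w)
    (hw2 : w + a ∈ F) (hxw2 : x ∈ c (w + a)) (hw3 : w + a + b ∈ F) (hxw3 : x ∈ c (w + a + b)) :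
    ∃ y₁ y₂ y₃ y₄ : X, bdry c F x ⊆ {y₁, y₂, y₃, y₄} := by
  refine h.hex3 hx hw hxw hw2 hxw2 hw3 hxw3 fun f hf hxf => ?_
  by_contra! hc
  obtain ⟨i, j, h1, e1⟩ := (hx.mem _).mp (h.dir w hw f hf hc.1.symm ⟨x, hxw, hxf⟩)
  obtain ⟨i', j', h2, e2⟩ := (hx.mem _).mp (h.dir _ hw2 f hf hc.2.1.symm ⟨x, hxw2, hxf⟩)
  obtain ⟨i'', j'', h3, e3⟩ := (hx.mem _).mp (h.dir _ hw3 f hf hc.2.2.symm ⟨x, hxw3, hxf⟩)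
  have k1 := hx.ind (i - i' - 1) (j - j') (by linear_combination e2 - e1)
  have k2 := hx.ind (i - i'' - 1) (j - j'' - 1) (by linear_combination e3 - e1)
  unfold hexset at *
  omega

theorem Conf.hex23 (h : Conf c F x Dir) (hx : Hex Dir a b) {w : ℤ × ℤ} (hw : w ∈ F) (hxw : x ∈ c w)
    (hw2 : w + a ∈ F) (hxw2 : x ∈ c (w + a)) :
    ∃ y₁ y₂ y₃ y₄ : X, bdry c F x ⊆ {y₁, y₂, y₃, y₄} := by
  by_cases h3 : ∃ f ∈ F, x ∈ c f ∧ f ≠ w ∧ f ≠ w + a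
  swap
  · refine h.hex2 hx hw hxw hw2 hxw2 fun f hf hxf => ?_
    by_contra! hc
    exact h3 ⟨f, hf, hxf, hc⟩
  obtain ⟨f, hf, hxf, hc1, hc2⟩ := h3
  obtain ⟨i, j, h1, e1⟩ := (hx.mem _).mp (h.dir w hw f hf hc1.symm ⟨x, hxw, hxf⟩)
  obtain ⟨i', j', h2, e2⟩ := (hx.mem _).mp (h.dir _ hw2 f hf hc2.symm ⟨x, hxw2, hxf⟩)
  have k1 := hx.ind (i - i' - 1) (j - j') (by linear_combination e2 - e1)
  unfold hexset at *
  rcases (by omega : (i = 1 ∧ j = 1) ∨ (i = 0 ∧ j = -1)) with ⟨rfl, rfl⟩ | ⟨rfl, rfl⟩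
  · obtain rfl : f = w + a + b := by rw [sub_eq_iff_eq_add'] at e1; rw [e1]; module
    exact h.hex3' hx hw hxw hw2 hxw2 hf hxf
  · obtain rfl : w = f + b := by rw [sub_eq_iff_eq_add'] at e1; rw [e1]; module
    exact h.hex3' hx.swap hf hxf hw hxw hw2 hxw2

theorem Conf.hex (h : Conf c F x Dir) (hx : Hex Dir a b) :
    ∃ y₁ y₂ y₃ y₄ : X, bdry c F x ⊆ {y₁, y₂, y₃, y₄} := by
  by_cases hne : ∃ w ∈ F, x ∈ c w
  swap
  · refine ⟨x, x, x, x, ?_⟩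
    rintro y ⟨f, g, hy⟩
    exact absurd ⟨f, hy.1, hy.2.1⟩ hne
  obtain ⟨w, hwF, hw⟩ := hne
  by_cases h1 : ∃ w' ∈ F, x ∈ c w' ∧ w ≠ w'
  swap
  · push Not at h1
    exact h.hex1 hx fun f hf hxf => (h1 f hf hxf).symm
  obtain ⟨w', hwF', hw', hww⟩ := h1
  have e : w' = w + (w' - w) := by abel
  have e' : w = w' + -(w' - w) := by abel
  rcases hx.cases (h.dir w hwF w' hwF' hww ⟨x, hw, hw'⟩) with hd | hd | hd | hd | hd | hd <;>
    rw [hd] at e e'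
  · subst e; exact h.hex23 hx hwF hw hwF' hw'
  · subst e; exact h.hex23 hx.rot hwF hw hwF' hw'
  · subst e; exact h.hex23 hx.swap hwF hw hwF' hw'
  · rw [neg_neg] at e'; rw [e'] at hwF hw; exact h.hex23 hx hwF' hw' hwF hw
  · rw [show -(-a - b) = a + b by abel] at e'; rw [e'] at hwF hw
    exact h.hex23 hx.rot hwF' hw' hwF hw
  · rw [neg_neg] at e'; rw [e'] at hwF hw; exact h.hex23 hx.swap hwF' hw' hwF hw

end conf

theorem Good.conf {K N F x} (h : Good K) (hF : FS N F K)
    (far : ∀ w ∈ F, x ∈ cell K w → ∀ w' ∈ F, x ∈ cell K w' → w ≠ w' → ∀ g ∈ F, x ∉ cell K g →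
      ∀ g' ∈ F, x ∉ cell K g' → (cell K w ∩ cell K g).Nonempty → (cell K w' ∩ cell K g').Nonempty →
      ¬ (cell K g ∩ cell K g').Nonempty) : Conf (cell K) F x (Occ K) where
  sub f hf g hg hfg := h.sub hF hf hg hfg
  dir f hf g hg hfg hn := Good.occ hF hf hg hfg hn
  touch δ hδ w := hδ.touch w
  neg δ hδ := hδ.neg
  nz δ hδ := hδ.1
  tri w hw w' hw' w'' hw'' h1 h2 p hp r hr hn := h.tri hF hw hw' hw'' h1 h2 hp hr hn
  far := far

theorem Good.occ_cases {K δ} (h : Good K) (ho : Occ K δ) :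
    ((δ = (1, 0) ∨ δ = -(1, 0)) ∧ Occ K (1, 0)) ∨ ((δ = (0, 1) ∨ δ = -(0, 1)) ∧ Occ K (0, 1)) ∨
    ((δ = (1, 1) ∨ δ = -(1, 1)) ∧ Occ K (1, 1)) ∨ ((δ = (1, -1) ∨ δ = -(1, -1)) ∧ Occ K (1, -1)) := by
  have hn := ho.neg
  obtain ⟨h0, h1, h2, h3, h4⟩ := h.occ_near ho
  obtain ⟨a, b⟩ := δ
  simp only [ne_eq, Prod.ext_iff, Prod.fst_zero, Prod.snd_zero] at h0 h1 h2 h3 h4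
  simp only [Prod.neg_mk] at hn ⊢
  have ha : a = -1 ∨ a = 0 ∨ a = 1 := by omega
  have hb : b = -1 ∨ b = 0 ∨ b = 1 := by omega
  rcases ha with rfl | rfl | rfl <;> rcases hb with rfl | rfl | rfl <;> simp_all

theorem Good.four {K F} {x : ℝ × ℝ} (h : Good K) (hc : Conf (cell K) F x (Occ K)) :
    ∃ y₁ y₂ y₃ y₄ : ℝ × ℝ, bdry (cell K) F x ⊆ {y₁, y₂, y₃, y₄} := by
  have two : ∀ u v : ℤ × ℤ, (∀ δ, Occ K δ → δ = u ∨ δ = -u ∨ δ = v ∨ δ = -v) →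
      (∀ i j : ℤ, i • u + j • v = 0 → i = 0 ∧ j = 0) →
      ∃ y₁ y₂ y₃ y₄ : ℝ × ℝ, bdry (cell K) F x ⊆ {y₁, y₂, y₃, y₄} := by
    intro u v hS hind
    have co : ∀ δ, Occ K δ → ∃ i j : ℤ, δ = i • u + j • v ∧ (i + j) % 2 = 1 := by
      intro δ hδ
      rcases hS δ hδ with rfl | rfl | rfl | rfl
      · exact ⟨1, 0, by module, by norm_num⟩
      · exact ⟨-1, 0, by module, by norm_num⟩
      · exact ⟨0, 1, by module, by norm_num⟩
      · exact ⟨0, -1, by module, by norm_num⟩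
    refine hc.two hS ?_
    intro a b ha hb hab
    obtain ⟨i, j, e1, p1⟩ := co a ha
    obtain ⟨i', j', e2, p2⟩ := co b hb
    obtain ⟨i'', j'', e3, p3⟩ := co _ hab
    have := hind (i - i' - i'') (j - j' - j'') (by
      rw [e1, e2] at e3
      linear_combination e3)
    omega
  have hex : ∀ a b : ℤ × ℤ, Occ K a → Occ K b → Occ K (a + b) →
      (∀ δ, Occ K δ → δ = a ∨ δ = -a ∨ δ = b ∨ δ = -b ∨ δ = a + b ∨ δ = -(a + b)) →
      (∀ i j : ℤ, i • a + j • b = 0 → i = 0 ∧ j = 0) →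
      ∃ y₁ y₂ y₃ y₄ : ℝ × ℝ, bdry (cell K) F x ⊆ {y₁, y₂, y₃, y₄} := by
    intro a b ha hb hab hS hind
    refine hc.hex (a := a) (b := b) ⟨fun δ => ⟨fun hδ => ?_, ?_⟩, hind⟩
    · rcases hS δ hδ with rfl | rfl | rfl | rfl | rfl | rfl
      · exact ⟨1, 0, by unfold hexset; norm_num, by module⟩
      · exact ⟨-1, 0, by unfold hexset; norm_num, by module⟩
      · exact ⟨0, 1, by unfold hexset; norm_num, by module⟩
      · exact ⟨0, -1, by unfold hexset; norm_num, by module⟩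
      · exact ⟨1, 1, by unfold hexset; norm_num, by module⟩
      · exact ⟨-1, -1, by unfold hexset; norm_num, by module⟩
    · rintro ⟨i, j, hh, rfl⟩
      unfold hexset at hh
      have : (i = 1 ∧ j = 0) ∨ (i = 1 ∧ j = 1) ∨ (i = 0 ∧ j = 1) ∨ (i = -1 ∧ j = 0) ∨
        (i = -1 ∧ j = -1) ∨ (i = 0 ∧ j = -1) := by omega
      rcases this with ⟨rfl, rfl⟩ | ⟨rfl, rfl⟩ | ⟨rfl, rfl⟩ | ⟨rfl, rfl⟩ | ⟨rfl, rfl⟩ | ⟨rfl, rfl⟩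
      · convert ha using 1; module
      · convert hab using 1; module
      · convert hb using 1; module
      · convert ha.neg using 1; module
      · convert hab.neg using 1; module
      · convert hb.neg using 1; module
  by_cases hd : Occ K (1, 1)
  · by_cases hd' : Occ K (1, -1)
    · obtain ⟨n1, n2⟩ := h.not_occ hd hd'
      refine two (1, 1) (1, -1) ?_ ?_
      · intro δ hδ
        have := h.occ_cases hδ
        tauto
      · intro i j e
        simp [Prod.ext_iff] at e
        omega
    · by_cases h1 : Occ K (1, 0)
      · by_cases h2 : Occ K (0, 1)
        · refine hex (1, 0) (0, 1) h1 h2 (by simpa using hd) ?_ ?_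
          · intro δ hδ
            have := h.occ_cases hδ
            rw [show ((1, 0) : ℤ × ℤ) + (0, 1) = (1, 1) by simp]
            tauto
          · intro i j e
            simp [Prod.ext_iff] at e
            omega
        · refine two (1, 0) (1, 1) ?_ ?_
          · intro δ hδ
            have := h.occ_cases hδ
            tauto
          · intro i j e
            simp [Prod.ext_iff] at e
            omega
      · refine two (0, 1) (1, 1) ?_ ?_
        · intro δ hδ
          have := h.occ_cases hδ
          tauto
        · intro i j e
          simp [Prod.ext_iff] at e
          omega
  · by_cases h1 : Occ K (1, 0)
    · by_cases h2 : Occ K (0, 1)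
      · by_cases hd' : Occ K (1, -1)
        · refine hex (1, 0) (-(0, 1)) h1 h2.neg (by simpa using hd') ?_ ?_
          · intro δ hδ
            have := h.occ_cases hδ
            rw [show ((1, 0) : ℤ × ℤ) + -(0, 1) = (1, -1) by simp, neg_neg]
            tauto
          · intro i j e
            simp [Prod.ext_iff] at e
            omega
        · refine two (1, 0) (0, 1) ?_ ?_
          · intro δ hδ
            have := h.occ_cases hδ
            tauto
          · intro i j e
            simp [Prod.ext_iff] at e
            omega
      · refine two (1, 0) (1, -1) ?_ ?_
        · intro δ hδ
          have := h.occ_cases hδ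
          tauto
        · intro i j e
          simp [Prod.ext_iff] at e
          omega
    · refine two (0, 1) (1, -1) ?_ ?_
      · intro δ hδ
        have := h.occ_cases hδ
        tauto
      · intro i j e
        simp [Prod.ext_iff] at e
        omega

theorem Good.card_le {K N E} (h : Good K) (hE : FS N E K) (x : ℝ × ℝ) :
    {e ∈ E | x ∈ cell K e}.ncard ≤ 4 := by
  have hsub : {e ∈ E | x ∈ cell K e} ⊆
      ((Finset.Icc (⌊x.1⌋ - 1) ⌊x.1⌋ ×ˢ Finset.Icc (⌊x.2⌋ - 1) ⌊x.2⌋ : Finset (ℤ × ℤ)) : Set (ℤ × ℤ)) := by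
    rintro e ⟨-, he⟩
    obtain ⟨a1, a2, a3, a4⟩ := h.cell_square he
    simp only [Finset.coe_product, Finset.coe_Icc, mem_prod, mem_Icc]
    have k1 := Int.le_floor.mpr a1
    have k2 := Int.le_floor.mpr a3
    have k3 : (⌊x.1⌋ : ℝ) ≤ e.1 + 1 := (Int.floor_le _).trans a2
    have k4 : (⌊x.2⌋ : ℝ) ≤ e.2 + 1 := (Int.floor_le _).trans a4
    norm_cast at k3 k4
    omega
  refine (Set.ncard_le_ncard hsub (Finset.finite_toSet _)).trans ?_
  rw [Set.ncard_coe_finset]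
  simp

theorem FS.descend {L D K} (hD : FS L D K) {e d : ℤ × ℤ} (hd : d ∈ D) {z : ℝ × ℝ}
    (hz : z ∈ cell K ((L : ℤ) • e + d)) : (L : ℝ)⁻¹ • z ∈ cell K e := by
  have hL : (L : ℝ) ≠ 0 := by have := hD.two; positivity
  refine (hD.eq _).mpr ⟨d, hd, ?_⟩
  have : (L : ℝ) • ((L : ℝ)⁻¹ • z - coeZ2 e) - coeZ2 d = z - coeZ2 ((L : ℤ) • e + d) := by
    rw [smul_sub, smul_inv_smul₀ hL, sub_sub]
    congr 1
    ext <;> simp [coeZ2]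
  rw [cell, mem_ofPred_eq, this]
  exact hz

theorem FS.ascend {L D K} (hD : FS L D K) {e : ℤ × ℤ} {y : ℝ × ℝ}
    (hy : y ∈ cell K e) : ∃ d ∈ D, (L : ℝ) • y ∈ cell K ((L : ℤ) • e + d) := by
  obtain ⟨d, hd, h⟩ := (hD.eq _).mp hy
  refine ⟨d, hd, ?_⟩
  have : (L : ℝ) • y - coeZ2 ((L : ℤ) • e + d) = (L : ℝ) • (y - coeZ2 e) - coeZ2 d := by
    ext <;> simp [coeZ2] <;> ring
  rw [cell, mem_ofPred_eq, this]
  exact h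

theorem FS.blk {L D K} (hD : FS L D K) {e d : ℤ × ℤ} (hd : d ∈ D) :
    ((((L : ℤ) • e + d).1 / L, ((L : ℤ) • e + d).2 / L) : ℤ × ℤ) = e := by
  obtain ⟨a1, a2, a3, a4⟩ := hD.dig d hd
  have hL := hD.two
  have hL' : (L : ℤ) ≠ 0 := by omega
  ext
  · simp only [Prod.fst_add, Prod.smul_fst, smul_eq_mul]
    rw [Int.mul_add_ediv_left _ _ hL', Int.ediv_eq_zero_of_lt a1 (by omega), add_zero]
  · simp only [Prod.snd_add, Prod.smul_snd, smul_eq_mul]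
    rw [Int.mul_add_ediv_left _ _ hL', Int.ediv_eq_zero_of_lt a3 (by omega), add_zero]

theorem Good.cell_dist {K} (h : Good K) {e : ℤ × ℤ} {y z} (hy : y ∈ cell K e) (hz : z ∈ cell K e) :
    dist y z ≤ 1 := by
  obtain ⟨a1, a2, a3, a4⟩ := h.cell_square hy
  obtain ⟨b1, b2, b3, b4⟩ := h.cell_square hz
  rw [Prod.dist_eq, Real.dist_eq, Real.dist_eq]
  refine max_le ?_ ?_ <;> rw [abs_le] <;> constructor <;> linarith

theorem Good.exists_far {K} (h : Good K) (x : ℝ × ℝ) {ε : ℝ} (hε : 0 < ε) :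
    ∃ M F, FS M F K ∧ 1 / (M : ℝ) < ε ∧ Conf (cell K) F ((M : ℝ) • x) (Occ K) := by
  let Q : ℕ → Prop := fun k => ∃ N E, FS N E K ∧ {e ∈ E | (N : ℝ) • x ∈ cell K e}.ncard = k
  have hQ : ∃ k, Q k ∧ ∀ k', Q k' → k' ≤ k := by
    obtain ⟨N, E, -, hE⟩ := h.deep 0
    classical
    have hb : ∀ k, Q k → k ≤ 4 := by
      rintro k ⟨N, E, hE, rfl⟩
      exact h.card_le hE _
    have h0 : Q _ := ⟨N, E, hE, rfl⟩
    exact ⟨Nat.findGreatest Q 4, Nat.findGreatest_spec (hb _ h0) h0,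
      fun k' hk' => Nat.le_findGreatest (hb _ hk') hk'⟩
  obtain ⟨_, ⟨N, E, hE, rfl⟩, hmax⟩ := hQ
  have hN : (0 : ℝ) < N := by have := hE.two; positivity
  let V0 : Set (ℝ × ℝ) := ⋃ e ∈ {e ∈ E | (N : ℝ) • x ∉ cell K e}, {y | (N : ℝ) • y ∈ cell K e}
  have hV0 : IsClosed V0 := (hE.finite.subset (sep_subset _ _)).isClosed_biUnion fun e _ =>
    (isClosed_cell h.compact.isClosed e).preimage (by fun_prop : Continuous fun y : ℝ × ℝ => (N : ℝ) • y)
  have hxV : x ∈ V0ᶜ := by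
    intro hx
    simp only [V0, mem_iUnion, mem_ofPred_eq, exists_prop] at hx
    obtain ⟨e, he, he'⟩ := hx
    exact he.2 he'
  obtain ⟨r, hr, hball⟩ := Metric.isOpen_iff.mp hV0.isOpen_compl x hxV
  obtain ⟨B, hB⟩ := exists_nat_gt (max (1 / ε) (1 / r))
  obtain ⟨L, D, hBL, hD⟩ := h.deep B
  have hL : (0 : ℝ) < L := by have := hD.two; positivity
  have hF := hE.comp hD
  have hML : (B : ℝ) ≤ ((N * L : ℕ) : ℝ) := by
    have h1 : 1 ≤ N := by have := hE.two; omega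
    exact_mod_cast hBL.trans (Nat.le_mul_of_pos_left L h1)
  have hM0 : (0 : ℝ) < ((N * L : ℕ) : ℝ) := by push_cast; positivity
  have hMε : 1 / ((N * L : ℕ) : ℝ) < ε := by
    rw [one_div_lt hM0 hε]
    exact (le_max_left _ _).trans_lt (hB.trans_le hML)
  have hMr : 1 / ((N * L : ℕ) : ℝ) < r := by
    rw [one_div_lt hM0 hr]
    exact (le_max_right _ _).trans_lt (hB.trans_le hML)
  refine ⟨N * L, _, hF, hMε, h.conf hF ?_⟩
  set X : ℝ × ℝ := ((N * L : ℕ) : ℝ) • x with hX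
  have hXL : (L : ℝ)⁻¹ • X = (N : ℝ) • x := by
    rw [hX, Nat.cast_mul, smul_smul]
    congr 1
    field_simp
  have hLX : (L : ℝ) • ((N : ℝ) • x) = X := by
    rw [← hXL, smul_inv_smul₀ hL.ne']
  set F : Set (ℤ × ℤ) := {f | ∃ e ∈ E, ∃ d ∈ D, f = (L : ℤ) • e + d} with hFdef
  let blk : ℤ × ℤ → ℤ × ℤ := fun f => (f.1 / L, f.2 / L)
  have blkE : ∀ f ∈ F, blk f ∈ E := by
    rintro _ ⟨e, he, d, hd, rfl⟩
    rw [show blk _ = e from hD.blk hd]; exact he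
  have blkc : ∀ f ∈ F, ∀ z ∈ cell K f, (L : ℝ)⁻¹ • z ∈ cell K (blk f) := by
    rintro _ ⟨e, he, d, hd, rfl⟩ z hz
    rw [show blk _ = e from hD.blk hd]
    exact hD.descend hd hz
  have hfin : {f ∈ F | X ∈ cell K f}.Finite := hF.finite.subset (sep_subset _ _)
  have hinj : ∀ w ∈ F, X ∈ cell K w → ∀ w' ∈ F, X ∈ cell K w' → blk w = blk w' → w = w' := by
    intro w hw hXw w' hw' hXw' heq
    refine Set.inj_on_of_surj_on_of_ncard_le (s := {f ∈ F | X ∈ cell K f})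
      (t := {e ∈ E | (N : ℝ) • x ∈ cell K e}) (fun f _ => blk f) ?_ ?_ ?_ ⟨hw, hXw⟩ ⟨hw', hXw'⟩ heq hfin
    · rintro f ⟨hf, hXf⟩
      refine ⟨blkE f hf, ?_⟩
      rw [← hXL]; exact blkc f hf X hXf
    · rintro e ⟨he, hxe⟩
      obtain ⟨d, hd, hz⟩ := hD.ascend hxe
      rw [hLX] at hz
      exact ⟨_, ⟨⟨e, he, d, hd, rfl⟩, hz⟩, hD.blk hd⟩
    · exact hmax _ ⟨N * L, F, hF, rfl⟩
  have hsame : ∀ f ∈ F, ∀ g ∈ F, X ∉ cell K g → ∀ y ∈ cell K f ∩ cell K g, (N : ℝ) • x ∈ cell K (blk f) →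
      (N : ℝ) • x ∈ cell K (blk g) → blk g = blk f := by
    intro f hf g hg hXg y hy h1 h2
    by_contra hne
    have := h.sub hE (blkE f hf) (blkE g hg) (Ne.symm hne) ⟨blkc f hf y hy.1, blkc g hg y hy.2⟩ ⟨h1, h2⟩
    rw [← hXL] at this
    have hyX : y = X := smul_right_injective _ (inv_ne_zero hL.ne') this
    exact hXg (hyX ▸ hy.2)
  have hnear : ∀ w ∈ F, X ∈ cell K w → ∀ g ∈ F, (cell K w ∩ cell K g).Nonempty →
      (N : ℝ) • x ∈ cell K (blk g) := by
    rintro w hw hXw g hg ⟨p, hp1, hp2⟩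
    by_contra hn
    have hd := h.cell_dist hp1 hXw
    have hpx : dist ((((N * L : ℕ) : ℝ))⁻¹ • p) x < r := by
      have : x = (((N * L : ℕ) : ℝ))⁻¹ • X := by rw [hX, inv_smul_smul₀ hM0.ne']
      rw [this, dist_smul₀, norm_inv, Real.norm_of_nonneg hM0.le]
      refine lt_of_le_of_lt ?_ hMr
      rw [one_div]
      exact mul_le_of_le_one_right (by positivity) hd
    refine hball hpx ?_
    simp only [V0, mem_iUnion, mem_ofPred_eq, exists_prop]
    refine ⟨blk g, ⟨blkE g hg, hn⟩, ?_⟩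
    have := blkc g hg p hp2
    rw [smul_smul, Nat.cast_mul]
    convert this using 2
    field_simp
  intro w hw hXw w' hw' hXw' hww g hg hXg g' hg' hXg' hwg hwg' hgg
  obtain ⟨y, hy⟩ := hgg
  have hxw : (N : ℝ) • x ∈ cell K (blk w) := by rw [← hXL]; exact blkc w hw X hXw
  have hxw' : (N : ℝ) • x ∈ cell K (blk w') := by rw [← hXL]; exact blkc w' hw' X hXw'
  have hxg := hnear w hw hXw g hg hwg
  have hxg' := hnear w' hw' hXw' g' hg' hwg'
  obtain ⟨p, hp⟩ := hwg
  obtain ⟨p', hp'⟩ := hwg'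
  have e1 := hsame w hw g hg hXg p hp hxw hxg
  have e2 := hsame w' hw' g' hg' hXg' p' hp' hxw' hxg'
  have e3 := hsame g hg g' hg' hXg' y hy hxg hxg'
  exact hww (hinj w hw hXw w' hw' hXw' (by rw [← e1, ← e2, e3]))

theorem FS.good {n D K} (h : FS n D K) (hden : IsDendrite K) : Good K := by
  obtain ⟨-, hc, hconn, -, hnc⟩ := hden
  refine ⟨hc, h.isPathConnected hc hconn, hnc, fun B => ?_⟩
  have hp : ∀ m : ℕ, ∃ E, FS (n ^ (m + 1)) E K := by
    intro m
    induction m with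
    | zero => exact ⟨D, by simpa using h⟩
    | succ m ih =>
      obtain ⟨E, hE⟩ := ih
      exact ⟨_, hE.comp h⟩
  obtain ⟨E, hE⟩ := hp B
  exact ⟨_, E, (Nat.le_succ B).trans (Nat.lt_pow_self (by have := h.two; omega)).le, hE⟩

theorem fractalSquare_main
    (n : ℕ) (D : Set (ℤ × ℤ)) (K : Set (ℝ × ℝ))
    (hK : IsFractalSquare n D K) (hden : IsDendrite K) :
    ∀ x ∈ K, Cardinal.mk (ConnectedComponents (K \ {x} : Set (ℝ × ℝ))) ≤ 4 := by
  intro x hx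
  have h : Good K := hK.fs.good hden
  refine comps_le_four hden.2.2.1 hden.2.2.2.1 hx fun ε hε => ?_
  obtain ⟨M, F, hF, hMε, hc⟩ := h.exists_far x hε
  have hM : (0 : ℝ) < M := by have := hF.two; positivity
  have hcl : ∀ P : Set (ℤ × ℤ), P ⊆ F → IsClosed (⋃ f ∈ P, {y : ℝ × ℝ | (M : ℝ) • y ∈ cell K f}) := by
    intro P hP
    exact (hF.finite.subset hP).isClosed_biUnion fun e _ =>
      (isClosed_cell h.compact.isClosed e).preimage (by fun_prop : Continuous fun y : ℝ × ℝ => (M : ℝ) • y)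
  refine ⟨_, _, hcl {f ∈ F | (M : ℝ) • x ∈ cell K f} (sep_subset _ _),
    hcl {f ∈ F | (M : ℝ) • x ∉ cell K f} (sep_subset _ _), ?_, ?_, ?_, ?_⟩
  · ext y
    simp only [mem_union, mem_iUnion, mem_ofPred_eq, exists_prop]
    rw [hF.eq]
    constructor
    · rintro ⟨f, hf, hy⟩
      by_cases hxf : (M : ℝ) • x ∈ cell K f
      · exact Or.inl ⟨f, ⟨hf, hxf⟩, hy⟩
      · exact Or.inr ⟨f, ⟨hf, hxf⟩, hy⟩
    · rintro (⟨f, ⟨hf, -⟩, hy⟩ | ⟨f, ⟨hf, -⟩, hy⟩) <;> exact ⟨f, hf, hy⟩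
  · intro y hy
    simp only [mem_iUnion, mem_ofPred_eq, exists_prop] at hy
    obtain ⟨f, ⟨hf, hxf⟩, hy⟩ := hy
    have hd := h.cell_dist hy hxf
    rw [dist_smul₀, Real.norm_of_nonneg hM.le] at hd
    rw [Metric.mem_ball]
    refine lt_of_le_of_lt ?_ hMε
    rw [le_div_iff₀ hM]; linarith
  · intro hy
    simp only [mem_iUnion, mem_ofPred_eq, exists_prop] at hy
    obtain ⟨f, ⟨hf, hxf⟩, hy⟩ := hy
    exact hxf hy
  · obtain ⟨y₁, y₂, y₃, y₄, hb⟩ := h.four hc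
    refine ⟨(M : ℝ)⁻¹ • y₁, (M : ℝ)⁻¹ • y₂, (M : ℝ)⁻¹ • y₃, (M : ℝ)⁻¹ • y₄, ?_⟩
    rintro y ⟨hy1, hy2⟩
    simp only [mem_iUnion, mem_ofPred_eq, exists_prop] at hy1 hy2
    obtain ⟨f, ⟨hf, hxf⟩, hy1⟩ := hy1
    obtain ⟨g, ⟨hg, hxg⟩, hy2⟩ := hy2
    have hm : (M : ℝ) • y ∈ bdry (cell K) F ((M : ℝ) • x) := ⟨f, g, hf, hxf, hg, hxg, hy1, hy2⟩
    have e : y = (M : ℝ)⁻¹ • ((M : ℝ) • y) := (inv_smul_smul₀ hM.ne' y).symm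
    rcases hb hm with h1 | h1 | h1 | h1 <;> rw [h1] at e <;> simp [← e]

/-- If a fractal square `K` is a dendrite, then for every `x ∈ K`
the set `K \ {x}` has at most 4 connected components, i.e. the Menger–Urysohn
order of every point of `K` is at most 4. -/
theorem fractalSquare_dendrite_order_le_four
    (n : ℕ) (D : Set (ℤ × ℤ)) (K : Set (ℝ × ℝ))
    (hK : IsFractalSquare n D K) (hden : IsDendrite K) :
    ∀ x ∈ K, Cardinal.mk (ConnectedComponents (K \ {x} : Set (ℝ × ℝ))) ≤ 4 :=
  fractalSquare_main n D K hK hden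
end
end

section
/- Let K be a fractal square of order n with digit set D, and suppose K is a dendrite. Then for every corner point a ∈ K ∩ {(0,0),(1,0),(0,1),(1,1)}, the set K \ {a} has at most 2 connected components (equivalently, the Menger–Urysohn order of a in K is at most 2). -/
open Set Pointwise

noncomputable section

/-- Structural facts used: `K` is the union of its order-`m` pieces. -/
def IsTiled (m : ℕ) (D : Set (ℤ × ℤ)) (K : Set (ℝ × ℝ)) : Prop :=
  D ⊆ Set.Icc (0, 0) ((m : ℤ) - 1, (m : ℤ) - 1) ∧ K = ⋃ d ∈ D, pieceMap m d '' K

theorem mem_piece_iff {m : ℕ} (hm : 1 ≤ m) {d : ℤ × ℤ} {K : Set (ℝ × ℝ)} {x : ℝ × ℝ} :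
    x ∈ pieceMap m d '' K ↔ ((m : ℝ) * x.1 - d.1, (m : ℝ) * x.2 - d.2) ∈ K := by
  have hm0 : (m : ℝ) ≠ 0 := by positivity
  constructor
  · rintro ⟨y, hy, rfl⟩
    convert hy using 1
    ext <;> simp [pieceMap, coeZ2] <;> field_simp <;> ring
  · intro h
    refine ⟨_, h, ?_⟩
    ext <;> simp [pieceMap, coeZ2] <;> field_simp

theorem IsTiled.mem_iff {m : ℕ} (hm : 1 ≤ m) {D : Set (ℤ × ℤ)} {K : Set (ℝ × ℝ)}
    (h : IsTiled m D K) (x : ℝ × ℝ) :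
    x ∈ K ↔ ∃ d ∈ D, ((m : ℝ) * x.1 - d.1, (m : ℝ) * x.2 - d.2) ∈ K := by
  conv_lhs => rw [h.2]
  simp only [mem_iUnion, mem_piece_iff hm, exists_prop]

theorem IsTiled.of_mem_iff {m : ℕ} (hm : 1 ≤ m) {D : Set (ℤ × ℤ)} {K : Set (ℝ × ℝ)}
    (hD : D ⊆ Set.Icc (0, 0) ((m : ℤ) - 1, (m : ℤ) - 1))
    (h : ∀ x : ℝ × ℝ,
      x ∈ K ↔ ∃ d ∈ D, ((m : ℝ) * x.1 - d.1, (m : ℝ) * x.2 - d.2) ∈ K) : IsTiled m D K := by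
  refine ⟨hD, ?_⟩
  ext x
  rw [h x]
  simp only [mem_iUnion, mem_piece_iff hm, exists_prop]

theorem IsTiled.bounds {m : ℕ} {D : Set (ℤ × ℤ)} {K : Set (ℝ × ℝ)}
    (h : IsTiled m D K) {d : ℤ × ℤ} (hd : d ∈ D) :
    0 ≤ d.1 ∧ 0 ≤ d.2 ∧ d.1 ≤ m - 1 ∧ d.2 ≤ m - 1 := by
  have := h.1 hd
  simp only [mem_Icc, Prod.le_def] at this
  tauto

theorem IsTiled.pow {n : ℕ} (hn : 2 ≤ n) {D : Set (ℤ × ℤ)} {K : Set (ℝ × ℝ)}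
    (h : IsTiled n D K) (k : ℕ) : ∃ D', IsTiled (n ^ k) D' K := by
  induction k with
  | zero =>
    refine ⟨{(0, 0)}, IsTiled.of_mem_iff (by simp) (by simp) (fun x => by simp)⟩
  | succ k ih =>
    obtain ⟨D', h'⟩ := ih
    have hk : 1 ≤ n ^ k := Nat.one_le_pow _ _ (by omega)
    refine ⟨{e | ∃ d ∈ D, ∃ d' ∈ D', e = (d.1 + n * d'.1, d.2 + n * d'.2)},
      IsTiled.of_mem_iff (Nat.one_le_pow _ _ (by omega)) ?_ ?_⟩
    · rintro e ⟨d, hd, d', hd', rfl⟩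
      obtain ⟨h1, h2, h3, h4⟩ := h.bounds hd
      obtain ⟨h1', h2', h3', h4'⟩ := h'.bounds hd'
      have hn' : (0 : ℤ) ≤ n := by positivity
      push_cast at *
      simp only [mem_Icc, Prod.le_def]
      refine ⟨⟨by positivity, by positivity⟩, ?_, ?_⟩
      · have := mul_le_mul_of_nonneg_left h3' hn'
        simp only [pow_succ]; linarith
      · have := mul_le_mul_of_nonneg_left h4' hn'
        simp only [pow_succ]; linarith
    · intro x
      rw [h'.mem_iff hk x]
      constructor
      · rintro ⟨d', hd', hx⟩
        obtain ⟨d, hd, hx⟩ := (h.mem_iff (by omega) _).1 hx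
        refine ⟨_, ⟨d, hd, d', hd', rfl⟩, ?_⟩
        convert hx using 2 <;> push_cast <;> ring
      · rintro ⟨_, ⟨d, hd, d', hd', rfl⟩, hx⟩
        refine ⟨d', hd', (h.mem_iff (by omega) _).2 ⟨d, hd, ?_⟩⟩
        convert hx using 2 <;> push_cast <;> ring

theorem IsTiled.unit {n : ℕ} (hn : 2 ≤ n) {D : Set (ℤ × ℤ)} {K : Set (ℝ × ℝ)}
    (h : IsTiled n D K) (hc : IsCompact K) :
    ∀ x ∈ K, 0 ≤ x.1 ∧ 0 ≤ x.2 ∧ x.1 ≤ 1 ∧ x.2 ≤ 1 := by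
  intro x hx
  have hne : K.Nonempty := ⟨x, hx⟩
  have hn' : (2 : ℝ) ≤ n := by exact_mod_cast hn
  obtain ⟨p, hp, hpm⟩ := hc.exists_isMinOn hne continuous_fst.continuousOn
  obtain ⟨q, hq, hqm⟩ := hc.exists_isMinOn hne continuous_snd.continuousOn
  obtain ⟨r, hr, hrm⟩ := hc.exists_isMaxOn hne continuous_fst.continuousOn
  obtain ⟨s, hs, hsm⟩ := hc.exists_isMaxOn hne continuous_snd.continuousOn
  refine ⟨le_trans ?_ (hpm hx), le_trans ?_ (hqm hx), le_trans (hrm hx) ?_,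
    le_trans (hsm hx) ?_⟩
  · obtain ⟨d, hd, hy⟩ := (h.mem_iff (by omega) _).1 hp
    have h1 : (0 : ℝ) ≤ d.1 := by exact_mod_cast (h.bounds hd).1
    have h2 : p.1 ≤ n * p.1 - d.1 := hpm hy
    nlinarith
  · obtain ⟨d, hd, hy⟩ := (h.mem_iff (by omega) _).1 hq
    have h1 : (0 : ℝ) ≤ d.2 := by exact_mod_cast (h.bounds hd).2.1
    have h2 : q.2 ≤ n * q.2 - d.2 := hqm hy
    nlinarith
  · obtain ⟨d, hd, hy⟩ := (h.mem_iff (by omega) _).1 hr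
    have h1 : (d.1 : ℝ) ≤ n - 1 := by exact_mod_cast (h.bounds hd).2.2.1
    have h2 : n * r.1 - d.1 ≤ r.1 := hrm hy
    nlinarith
  · obtain ⟨d, hd, hy⟩ := (h.mem_iff (by omega) _).1 hs
    have h1 : (d.2 : ℝ) ≤ n - 1 := by exact_mod_cast (h.bounds hd).2.2.2
    have h2 : n * s.2 - d.2 ≤ s.2 := hsm hy
    nlinarith

/-- Boundary bumping in the locally connected case. -/
theorem mem_closure_component {K : Set (ℝ × ℝ)} (hconn : IsPreconnected K)
    (hlc : LocallyConnectedSpace K) {a p : ℝ × ℝ} (ha : a ∈ K) (hp : p ∈ K \ {a}) :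
    a ∈ closure (connectedComponentIn (K \ {a}) p) := by
  by_contra hcl
  haveI : PreconnectedSpace K := isPreconnected_iff_preconnectedSpace.1 hconn
  set F : Set K := {x | x.1 ≠ a} with hF
  have hFo : IsOpen F := isOpen_ne_fun continuous_subtype_val continuous_const
  set C : Set K := connectedComponentIn F ⟨p, hp.1⟩ with hC
  have hpF : (⟨p, hp.1⟩ : K) ∈ F := hp.2
  have hCo : IsOpen C := hFo.connectedComponentIn
  have hCF : C ⊆ F := connectedComponentIn_subset _ _
  have himg : Subtype.val '' C ⊆ connectedComponentIn (K \ {a}) p := by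
    apply IsPreconnected.subset_connectedComponentIn
    · exact isPreconnected_connectedComponentIn.image _ continuous_subtype_val.continuousOn
    · exact ⟨_, mem_connectedComponentIn hpF, rfl⟩
    · rintro _ ⟨x, hx, rfl⟩
      exact ⟨x.2, hCF hx⟩
  have haC : (⟨a, ha⟩ : K) ∉ closure C := by
    intro hmem
    apply hcl
    apply closure_mono himg
    exact image_closure_subset_closure_image continuous_subtype_val ⟨_, hmem, rfl⟩
  have hCc : IsClosed C := by
    have hsub : closure C ⊆ C := by
      apply IsPreconnected.subset_connectedComponentIn
      · exact isPreconnected_connectedComponentIn.closure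
      · exact subset_closure (mem_connectedComponentIn hpF)
      · intro x hx hxa
        apply haC
        have : x = ⟨a, ha⟩ := Subtype.ext hxa
        rwa [← this]
    exact isClosed_of_closure_subset hsub
  have := IsClopen.eq_univ ⟨hCc, hCo⟩ ⟨_, mem_connectedComponentIn hpF⟩
  apply haC
  rw [this]; simp

theorem IsTiled.piece_subset {m : ℕ} {D : Set (ℤ × ℤ)} {K : Set (ℝ × ℝ)}
    (h : IsTiled m D K) {d : ℤ × ℤ} (hd : d ∈ D) : pieceMap m d '' K ⊆ K := by
  conv_rhs => rw [h.2]
  exact subset_biUnion_of_mem (u := fun d => pieceMap m d '' K) hd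

theorem continuous_pieceMap (m : ℕ) (d : ℤ × ℤ) : Continuous (pieceMap m d) := by
  unfold pieceMap; fun_prop

theorem component_contains_piece {m : ℕ} (hm : 1 ≤ m) {D : Set (ℤ × ℤ)} {K : Set (ℝ × ℝ)}
    (h : IsTiled m D K) (hc : IsCompact K) (hconn : IsPreconnected K)
    (hlc : LocallyConnectedSpace K)
    (hu : ∀ x ∈ K, 0 ≤ x.1 ∧ 0 ≤ x.2 ∧ x.1 ≤ 1 ∧ x.2 ≤ 1)
    (h0 : (0 : ℝ × ℝ) ∈ K) {p : ℝ × ℝ} (hp : p ∈ K \ {0})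
    (hpm : 1 < m * p.1 ∨ 1 < m * p.2) :
    ∃ d : ℤ × ℤ, (d = (0, 1) ∨ d = (1, 0) ∨ d = (1, 1)) ∧
      (pieceMap m d '' K ∩ pieceMap m (0, 0) '' K).Nonempty ∧
      pieceMap m d '' K ⊆ connectedComponentIn (K \ {0}) p := by
  have hm0 : (0 : ℝ) < m := by positivity
  set C := connectedComponentIn (K \ {0}) p with hC
  have hCsub : C ⊆ K \ {0} := connectedComponentIn_subset _ _
  have hDfin : D.Finite := (Set.finite_Icc _ _).subset h.1
  have hclosed : ∀ d, IsClosed (pieceMap m d '' K) := fun d =>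
    (hc.image (continuous_pieceMap m d)).isClosed
  have hU : IsClosed (⋃ d ∈ D \ {(0, 0)}, pieceMap m d '' K) :=
    (hDfin.subset diff_subset).isClosed_biUnion (fun d _ => hclosed d)
  have hpre : IsPreconnected C := isPreconnected_connectedComponentIn
  have key := isPreconnected_closed_iff.1 hpre _ _ (hclosed (0, 0)) hU ?_ ?_ ?_
  · obtain ⟨z, hzC, hz0, hzU⟩ := key
    simp only [mem_iUnion, exists_prop] at hzU
    obtain ⟨d, ⟨hdD, hd0⟩, hzd⟩ := hzU
    have b0 := hu _ ((mem_piece_iff hm).1 hz0)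
    have bd := hu _ ((mem_piece_iff hm).1 hzd)
    obtain ⟨d1, d2⟩ := d
    have hb := h.bounds hdD
    simp only at b0 bd hb
    push_cast at b0
    have e1 : d1 ≤ 1 := by
      have : (d1 : ℝ) ≤ 1 := by linarith
      exact_mod_cast this
    have e2 : d2 ≤ 1 := by
      have : (d2 : ℝ) ≤ 1 := by linarith
      exact_mod_cast this
    have hne : ¬ (d1 = 0 ∧ d2 = 0) := by
      rintro ⟨rfl, rfl⟩; exact hd0 rfl
    refine ⟨(d1, d2), ?_, ⟨z, hzd, hz0⟩, ?_⟩
    · simp only [Prod.mk.injEq]; omega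
    · rw [hC, connectedComponentIn_eq hzC]
      apply IsPreconnected.subset_connectedComponentIn
      · exact hconn.image _ (continuous_pieceMap m _).continuousOn
      · exact hzd
      · intro x hx
        refine ⟨h.piece_subset hdD hx, ?_⟩
        intro hx0
        rw [mem_singleton_iff] at hx0
        subst hx0
        have bx := hu _ ((mem_piece_iff hm).1 hx)
        simp at bx
        apply hne
        have q1 : d1 ≤ 0 := by exact_mod_cast bx.1
        have q2 : d2 ≤ 0 := by exact_mod_cast bx.2.1
        omega
  · intro x hx
    have hxK := (hCsub hx).1
    rw [h.2] at hxK
    simp only [mem_iUnion, exists_prop] at hxK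
    obtain ⟨d, hd, hx⟩ := hxK
    by_cases hd0 : d = (0, 0)
    · left; rwa [← hd0]
    · right
      simp only [mem_iUnion, exists_prop]
      exact ⟨d, ⟨hd, hd0⟩, hx⟩
  · have hcl := mem_closure_component hconn hlc h0 hp
    rw [Metric.mem_closure_iff] at hcl
    obtain ⟨q, hqC, hq⟩ := hcl ((m : ℝ)⁻¹) (by positivity)
    refine ⟨q, hqC, ?_⟩
    have hqK := (hCsub hqC).1
    rw [dist_comm, dist_zero_right, Prod.norm_def, max_lt_iff, Real.norm_eq_abs,
      Real.norm_eq_abs] at hq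
    have l1 : m * q.1 < 1 := by
      have := lt_of_le_of_lt (le_abs_self _) hq.1
      rwa [← one_div, lt_div_iff₀' hm0] at this
    have l2 : m * q.2 < 1 := by
      have := lt_of_le_of_lt (le_abs_self _) hq.2
      rwa [← one_div, lt_div_iff₀' hm0] at this
    obtain ⟨d, hd, hy⟩ := (h.mem_iff hm _).1 hqK
    have hby := hu _ hy
    simp only at hby
    have hb := h.bounds hd
    have e1 : d.1 < 1 := by
      have : (d.1 : ℝ) < 1 := by linarith
      exact_mod_cast this
    have e2 : d.2 < 1 := by
      have : (d.2 : ℝ) < 1 := by linarith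
      exact_mod_cast this
    have : d = (0, 0) := by ext <;> simp <;> omega
    rw [this] at hy
    exact (mem_piece_iff hm).2 hy
  · refine ⟨p, mem_connectedComponentIn hp, ?_⟩
    obtain ⟨d, hd, hy⟩ := (h.mem_iff hm _).1 hp.1
    simp only [mem_iUnion, exists_prop]
    refine ⟨d, ⟨hd, ?_⟩, (mem_piece_iff hm).2 hy⟩
    rintro rfl
    have hby := hu _ hy
    simp at hby
    rcases hpm with hpm | hpm <;> linarith

theorem core_zero {n : ℕ} (hn : 2 ≤ n) {D : Set (ℤ × ℤ)} {K : Set (ℝ × ℝ)}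
    (h : IsTiled n D K) (hc : IsCompact K) (hconn : IsPreconnected K)
    (hlc : LocallyConnectedSpace K) (h0 : (0 : ℝ × ℝ) ∈ K)
    {p q r : ℝ × ℝ} (hp : p ∈ K \ {0}) (hq : q ∈ K \ {0}) (hr : r ∈ K \ {0}) :
    connectedComponentIn (K \ {0}) p = connectedComponentIn (K \ {0}) q ∨
    connectedComponentIn (K \ {0}) p = connectedComponentIn (K \ {0}) r ∨
    connectedComponentIn (K \ {0}) q = connectedComponentIn (K \ {0}) r := by
  have hu := h.unit hn hc
  have hk : ∀ x ∈ K \ {0}, ∃ k : ℕ, ∀ j ≥ k,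
      1 < ((n ^ j : ℕ) : ℝ) * x.1 ∨ 1 < ((n ^ j : ℕ) : ℝ) * x.2 := by
    intro x hx
    have hn1 : (1 : ℝ) < n := by exact_mod_cast hn
    have hux := hu x hx.1
    have aux : ∀ t : ℝ, 0 < t → ∃ k : ℕ, ∀ j ≥ k, 1 < ((n ^ j : ℕ) : ℝ) * t := by
      intro t ht
      obtain ⟨k, hk⟩ := pow_unbounded_of_one_lt (1 / t) hn1
      refine ⟨k, fun j hj => ?_⟩
      have h1 : (n : ℝ) ^ k ≤ n ^ j := pow_le_pow_right₀ hn1.le hj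
      rw [div_lt_iff₀ ht] at hk
      push_cast
      nlinarith
    by_cases hx1 : 0 < x.1
    · obtain ⟨k, hk⟩ := aux _ hx1
      exact ⟨k, fun j hj => Or.inl (hk j hj)⟩
    · have hx2 : 0 < x.2 := by
        by_contra hx2
        apply hx.2
        rw [mem_singleton_iff]
        ext
        · simp; linarith
        · simp; linarith
      obtain ⟨k, hk⟩ := aux _ hx2
      exact ⟨k, fun j hj => Or.inr (hk j hj)⟩
  obtain ⟨k1, hk1⟩ := hk p hp
  obtain ⟨k2, hk2⟩ := hk q hq
  obtain ⟨k3, hk3⟩ := hk r hr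
  set j := max k1 (max k2 k3) with hj
  obtain ⟨D', h'⟩ := h.pow hn j
  have hm : 1 ≤ n ^ j := Nat.one_le_pow _ _ (by omega)
  have C1 := component_contains_piece hm h' hc hconn hlc hu h0 hp (hk1 j (by omega))
  have C2 := component_contains_piece hm h' hc hconn hlc hu h0 hq (hk2 j (by omega))
  have C3 := component_contains_piece hm h' hc hconn hlc hu h0 hr (hk3 j (by omega))
  clear_value j
  generalize n ^ j = m at *
  have eqc : ∀ {x y z : ℝ × ℝ}, z ∈ connectedComponentIn (K \ {0}) x →
      z ∈ connectedComponentIn (K \ {0}) y →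
      connectedComponentIn (K \ {0}) x = connectedComponentIn (K \ {0}) y := by
    intro x y z hx hy
    rw [connectedComponentIn_eq hx, connectedComponentIn_eq hy]
  have meet : (pieceMap m (1, 0) '' K ∩ pieceMap m (0, 0) '' K).Nonempty →
      (pieceMap m (0, 1) '' K ∩ pieceMap m (1, 1) '' K).Nonempty := by
    rintro ⟨z, hz1, hz0⟩
    have hm0 : (0 : ℝ) < m := by positivity
    rw [mem_piece_iff hm] at hz1 hz0
    have b1 := hu _ hz1
    have b0 := hu _ hz0
    simp at b1 b0 hz1 hz0
    have hz : m * z.1 = 1 := by linarith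
    refine ⟨(z.1, z.2 + 1 / m), ?_, ?_⟩
    · rw [mem_piece_iff hm]
      convert hz0 using 2
      · simp
      · simp; field_simp; ring
    · rw [mem_piece_iff hm]
      convert hz1 using 2
      · simp
      · simp; field_simp; ring
  have same : ∀ {x y : ℝ × ℝ} {d e : ℤ × ℤ},
      (pieceMap m d '' K ∩ pieceMap m e '' K).Nonempty →
      pieceMap m d '' K ⊆ connectedComponentIn (K \ {0}) x →
      pieceMap m e '' K ⊆ connectedComponentIn (K \ {0}) y →
      connectedComponentIn (K \ {0}) x = connectedComponentIn (K \ {0}) y := by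
    rintro x y d e ⟨z, hzd, hze⟩ hx hy
    exact eqc (hx hzd) (hy hze)
  have slf : ∀ d, (pieceMap m d '' K ∩ pieceMap m d '' K).Nonempty := by
    intro d
    rw [inter_self]
    exact Nonempty.image _ ⟨_, h0⟩
  obtain ⟨d, hd, nd, sd⟩ := C1
  obtain ⟨e, he, ne, se⟩ := C2
  obtain ⟨f, hf, nf, sf⟩ := C3
  by_cases hde : d = e
  · subst hde; exact Or.inl (same (slf d) sd se)
  by_cases hdf : d = f
  · subst hdf; exact Or.inr (Or.inl (same (slf d) sd sf))
  by_cases hef : e = f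
  · subst hef; exact Or.inr (Or.inr (same (slf e) se sf))
  rcases hd with rfl | rfl | rfl <;> rcases he with rfl | rfl | rfl <;>
    first
    | exact absurd rfl hde
    | (rcases hf with rfl | rfl | rfl <;>
        first
        | exact absurd rfl hdf
        | exact absurd rfl hef
        | exact Or.inl (same (meet nf) sd se)
        | exact Or.inl (same (meet nf) se sd).symm
        | exact Or.inr (Or.inl (same (meet ne) sd sf))
        | exact Or.inr (Or.inl (same (meet ne) sf sd).symm)
        | exact Or.inr (Or.inr (same (meet nd) se sf))
        | exact Or.inr (Or.inr (same (meet nd) sf se).symm))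

theorem card_le_two_of_forall {a : ℝ × ℝ} {K : Set (ℝ × ℝ)}
    (H : ∀ p ∈ K \ {a}, ∀ q ∈ K \ {a}, ∀ r ∈ K \ {a},
      connectedComponentIn (K \ {a}) p = connectedComponentIn (K \ {a}) q ∨
      connectedComponentIn (K \ {a}) p = connectedComponentIn (K \ {a}) r ∨
      connectedComponentIn (K \ {a}) q = connectedComponentIn (K \ {a}) r) :
    Cardinal.mk (ConnectedComponents (K \ {a} : Set (ℝ × ℝ))) ≤ 2 := by
  by_contra hcon
  rw [not_le] at hcon
  have h3 : (3 : Cardinal) ≤ Cardinal.mk (ConnectedComponents (K \ {a} : Set (ℝ × ℝ))) := by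
    have := Order.succ_le_of_lt hcon
    have e : Order.succ (2 : Cardinal) = 3 := by
      have := Cardinal.nat_succ 2
      norm_num at this
      exact this.symm
    rwa [e] at this
  have h3' : Cardinal.mk (Fin 3) ≤
      Cardinal.mk (ConnectedComponents (K \ {a} : Set (ℝ × ℝ))) := by simpa using h3
  obtain ⟨f⟩ : Nonempty (Fin 3 ↪ ConnectedComponents (K \ {a} : Set (ℝ × ℝ))) := by
    rw [← Cardinal.lift_mk_le']
    simpa using h3
  choose g hg using fun i => ConnectedComponents.surjective_coe (f i)
  have key : ∀ i j, connectedComponentIn (K \ {a}) (g i).1 =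
      connectedComponentIn (K \ {a}) (g j).1 → i = j := by
    intro i j hij
    apply f.injective
    rw [← hg i, ← hg j, ConnectedComponents.coe_eq_coe]
    rw [connectedComponentIn_eq_image (g i).2, connectedComponentIn_eq_image (g j).2] at hij
    exact Subtype.val_injective.image_injective hij
  rcases H _ (g 0).2 _ (g 1).2 _ (g 2).2 with h | h | h
  · exact absurd (key _ _ h) (by decide)
  · exact absurd (key _ _ h) (by decide)
  · exact absurd (key _ _ h) (by decide)

/-- Reflection in one coordinate of the unit square. -/
def reflX : (ℝ × ℝ) ≃ₜ (ℝ × ℝ) := (Homeomorph.subLeft (1 : ℝ)).prodCongr (Homeomorph.refl ℝ)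

/-- Reflection in the other coordinate of the unit square. -/
def reflY : (ℝ × ℝ) ≃ₜ (ℝ × ℝ) := (Homeomorph.refl ℝ).prodCongr (Homeomorph.subLeft (1 : ℝ))

theorem reflX_apply (x : ℝ × ℝ) : reflX x = (1 - x.1, x.2) := rfl
theorem reflY_apply (x : ℝ × ℝ) : reflY x = (x.1, 1 - x.2) := rfl

/-- The property proved at each corner. -/
def Good_s1 (K : Set (ℝ × ℝ)) (a : ℝ × ℝ) : Prop :=
  ∀ p ∈ K \ {a}, ∀ q ∈ K \ {a}, ∀ r ∈ K \ {a},
      connectedComponentIn (K \ {a}) p = connectedComponentIn (K \ {a}) q ∨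
      connectedComponentIn (K \ {a}) p = connectedComponentIn (K \ {a}) r ∨
      connectedComponentIn (K \ {a}) q = connectedComponentIn (K \ {a}) r

theorem Good_s1.of_image (φ : (ℝ × ℝ) ≃ₜ (ℝ × ℝ)) {K : Set (ℝ × ℝ)} {a : ℝ × ℝ}
    (h : Good_s1 (φ '' K) (φ a)) : Good_s1 K a := by
  have e : φ '' (K \ {a}) = φ '' K \ {φ a} := by
    rw [image_diff φ.injective, image_singleton]
  have key : ∀ {x y}, x ∈ K \ {a} → y ∈ K \ {a} →
      connectedComponentIn (φ '' K \ {φ a}) (φ x) =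
        connectedComponentIn (φ '' K \ {φ a}) (φ y) →
      connectedComponentIn (K \ {a}) x = connectedComponentIn (K \ {a}) y := by
    intro x y hx hy hxy
    rw [← e, ← φ.image_connectedComponentIn hx, ← φ.image_connectedComponentIn hy] at hxy
    exact φ.injective.image_injective hxy
  intro p hp q hq r hr
  have m : ∀ {x}, x ∈ K \ {a} → φ x ∈ φ '' K \ {φ a} := fun hx => e ▸ mem_image_of_mem φ hx
  rcases h _ (m hp) _ (m hq) _ (m hr) with h | h | h
  · exact Or.inl (key hp hq h)
  · exact Or.inr (Or.inl (key hp hr h))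
  · exact Or.inr (Or.inr (key hq hr h))

/-- Hypotheses on `K` stable under reflections. -/
def Nice (n : ℕ) (K : Set (ℝ × ℝ)) : Prop :=
  (∃ D, IsTiled n D K) ∧ IsCompact K ∧ IsPreconnected K ∧ LocallyConnectedSpace K

theorem nice_topo (φ : (ℝ × ℝ) ≃ₜ (ℝ × ℝ)) {n : ℕ} {K : Set (ℝ × ℝ)} (h : Nice n K)
    (hD : ∃ D, IsTiled n D (φ '' K)) : Nice n (φ '' K) := by
  obtain ⟨_, h1, h2, h3⟩ := h
  refine ⟨hD, h1.image φ.continuous, h2.image _ φ.continuous.continuousOn, ?_⟩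
  exact (φ.image K).symm.isOpenEmbedding.locallyConnectedSpace

theorem Nice.reflX {n : ℕ} (hn : 2 ≤ n) {K : Set (ℝ × ℝ)} (h : Nice n K) :
    Nice n (reflX '' K) := by
  apply nice_topo _ h
  obtain ⟨⟨D, hD⟩, -⟩ := h
  have hmem : ∀ x : ℝ × ℝ, x ∈ _root_.reflX '' K ↔ (1 - x.1, x.2) ∈ K := by
    intro x
    constructor
    · rintro ⟨y, hy, rfl⟩
      simpa [reflX_apply] using hy
    · intro hx
      exact ⟨_, hx, by simp [reflX_apply]⟩
  refine ⟨{e | ((n : ℤ) - 1 - e.1, e.2) ∈ D}, IsTiled.of_mem_iff (by omega) ?_ ?_⟩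
  · intro e he
    have := hD.bounds he
    simp only [mem_Icc, Prod.le_def] at this ⊢
    omega
  · intro x
    rw [hmem, hD.mem_iff (by omega)]
    constructor
    · rintro ⟨d, hd, hx⟩
      refine ⟨((n : ℤ) - 1 - d.1, d.2), by simpa using hd, (hmem _).2 ?_⟩
      convert hx using 2
      push_cast; ring
    · rintro ⟨d, hd, hx⟩
      refine ⟨_, hd, ?_⟩
      convert (hmem _).1 hx using 2
      push_cast; ring

theorem Nice.reflY {n : ℕ} (hn : 2 ≤ n) {K : Set (ℝ × ℝ)} (h : Nice n K) :
    Nice n (reflY '' K) := by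
  apply nice_topo _ h
  obtain ⟨⟨D, hD⟩, -⟩ := h
  have hmem : ∀ x : ℝ × ℝ, x ∈ _root_.reflY '' K ↔ (x.1, 1 - x.2) ∈ K := by
    intro x
    constructor
    · rintro ⟨y, hy, rfl⟩
      simpa [reflY_apply] using hy
    · intro hx
      exact ⟨_, hx, by simp [reflY_apply]⟩
  refine ⟨{e | (e.1, (n : ℤ) - 1 - e.2) ∈ D}, IsTiled.of_mem_iff (by omega) ?_ ?_⟩
  · intro e he
    have := hD.bounds he
    simp only [mem_Icc, Prod.le_def] at this ⊢
    omega
  · intro x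
    rw [hmem, hD.mem_iff (by omega)]
    constructor
    · rintro ⟨d, hd, hx⟩
      refine ⟨(d.1, (n : ℤ) - 1 - d.2), by simpa using hd, (hmem _).2 ?_⟩
      convert hx using 2
      push_cast; ring
    · rintro ⟨d, hd, hx⟩
      refine ⟨_, hd, ?_⟩
      convert (hmem _).1 hx using 2
      push_cast; ring

theorem Nice.good {n : ℕ} (hn : 2 ≤ n) {K : Set (ℝ × ℝ)} (h : Nice n K) {a : ℝ × ℝ}
    (ha : a = 0) (haK : a ∈ K) : Good_s1 K a := by
  subst ha
  obtain ⟨⟨D, hD⟩, h1, h2, h3⟩ := h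
  exact fun p hp q hq r hr => core_zero hn hD h1 h2 h3 haK hp hq hr

/-- If a fractal square `K` is a dendrite, then every corner point
`a ∈ K ∩ {(0,0),(1,0),(0,1),(1,1)}` has Menger–Urysohn order at most 2 in `K`:
`K \ {a}` has at most 2 connected components. -/
theorem fractalSquare_dendrite_corner_order_le_two
    (n : ℕ) (D : Set (ℤ × ℤ)) (K : Set (ℝ × ℝ))
    (hK : IsFractalSquare n D K) (hden : IsDendrite K)
    (a : ℝ × ℝ) (haK : a ∈ K)
    (hacorner : a ∈ ({((0 : ℝ), (0 : ℝ)), (1, 0), (0, 1), (1, 1)} : Set (ℝ × ℝ))) :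
    Cardinal.mk (ConnectedComponents (K \ {a} : Set (ℝ × ℝ))) ≤ 2 := by
  obtain ⟨hn, hD, -, -, -, hc, hKeq⟩ := hK
  obtain ⟨-, -, hconn, hlc, -⟩ := hden
  have hnice : Nice n K := ⟨⟨D, hD, hKeq⟩, hc, hconn.isPreconnected, hlc⟩
  apply card_le_two_of_forall
  change Good_s1 K a
  simp only [mem_insert_iff, mem_singleton_iff] at hacorner
  rcases hacorner with rfl | rfl | rfl | rfl
  · exact hnice.good hn rfl haK
  · apply Good_s1.of_image reflX
    exact (hnice.reflX hn).good hn (by simp [reflX_apply]) (mem_image_of_mem _ haK)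
  · apply Good_s1.of_image reflY
    exact (hnice.reflY hn).good hn (by simp [reflY_apply]) (mem_image_of_mem _ haK)
  · apply Good_s1.of_image reflX
    apply Good_s1.of_image reflY
    exact ((hnice.reflX hn).reflY hn).good hn (by simp [reflX_apply, reflY_apply])
      (mem_image_of_mem _ (mem_image_of_mem _ haK))
end
end
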